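/- arXiv:1904.01796 — 2 statements merged into one kernel-verified Lean document; each statement's English description precedes it below -/
import Mathlib

section
/- Let (ρ, u) be a classical solution of the 3D compressible Euler equations with pressure p(ρ) = ρ²/2 on [0,T) × ℝ³, with initial data ρ(0,·) = 1 + ρ₀, u(0,·) = u₀, where ρ₀, u₀ are smooth and supported in {|x| ≤ 1}, and suppose that for each t ∈ [0,T), ρ(t,·) − 1 and u(t,·) are supported in {|x| ≤ 1 + t}. If ε := ∫_{ℝ³}∫_{S²} e^{ω·x} ρ₀(x) dσ(ω) dx + ∫_{ℝ³}∫_{S²} e^{ω·x} (1+ρ₀(x)) (u₀(x)·ω) dσ(ω) dx > 0, then T < ∞; moreover there is a universal constant C > 0 such that T ≤ e^{C/ε}. -/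
open MeasureTheory Real Set Metric
open scoped ENNReal RealInnerProductSpace

noncomputable section

/-- `ℝ³` as a Euclidean space. -/
abbrev E3 : Type := EuclideanSpace ℝ (Fin 3)

/-- The surface measure on the unit sphere `S² ⊆ ℝ³`. -/
def sphμ : Measure (sphere (0 : E3) 1) := (volume : Measure E3).toSphere

/-- The spatial partial derivative `∂ᵢ f`. -/
def pdv (i : Fin 3) (f : E3 → ℝ) (x : E3) : ℝ := fderiv ℝ f x (EuclideanSpace.single i 1)

/-- The time interval `[0, T)` for an extended-real final time `T ∈ (0, ∞]`. -/
def timeSet (T : ℝ≥0∞) : Set ℝ := {t : ℝ | 0 ≤ t ∧ ENNReal.ofReal t < T}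

/-- `(ρ, u)` is a classical solution on `[0,T) × ℝ³` of the compressible Euler equations
`∂ₜρ + div(ρu) = 0`, `∂ₜ(ρu) + div(ρu⊗u) + ∇(ρ²/2) = 0`, with positive density. -/
structure IsEulerSolution (T : ℝ≥0∞) (ρ : ℝ → E3 → ℝ) (u : ℝ → E3 → E3) : Prop where
  contDiff_rho : ContDiffOn ℝ 1 (fun p : ℝ × E3 => ρ p.1 p.2) (timeSet T ×ˢ univ)
  contDiff_u : ContDiffOn ℝ 1 (fun p : ℝ × E3 => u p.1 p.2) (timeSet T ×ˢ univ)
  rho_pos : ∀ t ∈ timeSet T, ∀ x, 0 < ρ t x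
  mass : ∀ t ∈ timeSet T, ∀ x : E3,
    derivWithin (fun s => ρ s x) (timeSet T) t
      + ∑ i, pdv i (fun y => ρ t y * u t y i) x = 0
  momentum : ∀ t ∈ timeSet T, ∀ x : E3, ∀ j : Fin 3,
    derivWithin (fun s => ρ s x * u s x j) (timeSet T) t
      + ∑ i, pdv i (fun y => ρ t y * u t y i * u t y j) x
      + pdv j (fun y => ρ t y ^ 2 / 2) x = 0


set_option maxHeartbeats 800000 in
lemma ode_bound (M : ℝ) (hM : 0 ≤ M) (t1 : ℝ) (h1 : 1 ≤ t1) (a X X' : ℝ → ℝ)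
    (hac : ContinuousOn a (Icc 0 t1)) (hXc : ContinuousOn X (Icc 0 t1))
    (ha : ∀ t ∈ Ioo 0 t1, HasDerivAt a (X t - 2 * a t) t)
    (hX : ∀ t ∈ Ioo 0 t1, HasDerivAt X (X' t) t)
    (hX' : ∀ t ∈ Ioo 0 t1, ∀ b : ℝ, b * a t - b ^ 2 / 2 * (M * (1 + t)) ≤ X' t) :
    X 0 ≤ 5000 * M / log (1 + t1) := by
  set L := log (1 + t1) with hL
  have hL2 : (0.69 : ℝ) < L := by
    have : log 2 ≤ L := log_le_log (by norm_num) (by linarith)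
    have := log_two_gt_d9
    linarith
  have hL0 : 0 < L := by linarith
  set s : ℝ → ℝ := fun t => log (1 + t) / L with hs
  set η : ℝ → ℝ := fun t => (1 - s t ^ 2) ^ 4 with hη
  set η1 : ℝ → ℝ := fun t => -8 * s t * (1 - s t ^ 2) ^ 3 / (L * (1 + t)) with hη1
  set η2 : ℝ → ℝ := fun t => (-8 * (1 - s t ^ 2) ^ 3 + 48 * s t ^ 2 * (1 - s t ^ 2) ^ 2) /
      (L ^ 2 * (1 + t) ^ 2) + 8 * s t * (1 - s t ^ 2) ^ 3 / (L * (1 + t) ^ 2) with hη2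
  have ds : ∀ t ∈ Icc 0 t1, HasDerivAt s (1 / (L * (1 + t))) t := by
    intro t ht
    have h : (1 + t) ≠ 0 := by linarith [ht.1]
    have := (((hasDerivAt_id t).const_add 1).log h).div_const L
    refine HasDerivAt.congr_deriv this ?_
    simp only [id]; field_simp
  have dη : ∀ t ∈ Icc 0 t1, HasDerivAt η (η1 t) t := by
    intro t ht
    have h : (1 + t) ≠ 0 := by linarith [ht.1]
    have := (((ds t ht).pow 2).const_sub 1).pow 4
    refine HasDerivAt.congr_deriv this ?_
    simp only [hη1, Pi.pow_apply]; field_simp; ring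
  have dη1 : ∀ t ∈ Icc 0 t1, HasDerivAt η1 (η2 t) t := by
    intro t ht
    have h : (1 + t) ≠ 0 := by linarith [ht.1]
    have := (((ds t ht).const_mul (-8)).mul ((((ds t ht).pow 2).const_sub 1).pow 3)).div
      (((hasDerivAt_id t).const_add 1).const_mul L) (by simp; exact ⟨hL0.ne', h⟩)
    refine HasDerivAt.congr_deriv this ?_
    simp only [hη2, id, Pi.pow_apply, Pi.mul_apply]; field_simp; ring
  set Z : ℝ → ℝ := fun t => η t * X t - η1 t * a t + 5000 * M / L ^ 2 * log (1 + t) with hZ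
  have hmono : MonotoneOn Z (Icc 0 t1) := by
    refine monotoneOn_of_hasDerivWithinAt_nonneg (convex_Icc 0 t1)
      (f' := fun t => (η1 t * X t + η t * X' t) - (η2 t * a t + η1 t * (X t - 2 * a t))
        + 5000 * M / L ^ 2 * (1 / (1 + t))) ?_ ?_ ?_
    · have c1 : ContinuousOn η (Icc 0 t1) := fun t ht => (dη t ht).continuousAt.continuousWithinAt
      have c2 : ContinuousOn η1 (Icc 0 t1) := fun t ht => (dη1 t ht).continuousAt.continuousWithinAt
      have c3 : ContinuousOn (fun t => log (1 + t)) (Icc 0 t1) :=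
        ContinuousOn.log (by fun_prop) (fun t ht => by linarith [ht.1])
      exact ((c1.mul hXc).sub (c2.mul hac)).add (continuousOn_const.mul c3)
    · intro t ht
      rw [interior_Icc] at ht
      have ht' := Ioo_subset_Icc_self ht
      have h : (1 + t) ≠ 0 := by linarith [ht.1]
      exact ((((dη t ht').mul (hX t ht)).sub ((dη1 t ht').mul (ha t ht))).add
        ((((hasDerivAt_id t).const_add 1).log h).const_mul _)).hasDerivWithinAt
    · intro t ht
      rw [interior_Icc] at ht
      have h : 0 < (1 + t) := by linarith [ht.1]
      have s0 : 0 ≤ s t := div_nonneg (log_nonneg (by linarith [ht.1])) hL0.le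
      have s1 : s t < 1 := by
        rw [hs]; simp only; rw [div_lt_one hL0]
        exact log_lt_log h (by linarith [ht.2])
      set q := 1 - s t ^ 2 with hq
      have q0 : 0 < q := by nlinarith
      have q1 : q ≤ 1 := by nlinarith [sq_nonneg (s t)]
      have hη0 : η t = q ^ 4 := rfl
      set w := η2 t - 2 * η1 t with hw
      set N := (-8 * q + 48 * s t ^ 2) + 8 * s t * q * L + 16 * s t * q * L * (1 + t) with hN
      have hwe : w = q ^ 2 * N / (L ^ 2 * (1 + t) ^ 2) := by
        rw [hw, hη2, hη1, hN]; simp only; rw [← hq]; field_simp; ring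
      have hNb : |N| ≤ 100 * L * (1 + t) := by
        have e1 : 0 ≤ s t * q := by positivity
        have e2 : s t * q ≤ 1 := by nlinarith
        have e3 : 0 ≤ s t * q * L := by positivity
        have e4 : s t * q * L ≤ L := by nlinarith
        have e5 : s t * q * L * (1 + t) ≤ L * (1 + t) := by gcongr
        have e6 : 0 ≤ s t * q * L * (1 + t) := by positivity
        have e7 : L ≤ L * (1 + t) := by nlinarith [ht.1]
        have e8 : s t ^ 2 ≤ 1 := by nlinarith
        rw [abs_le]; constructor <;> nlinarith [sq_nonneg (s t)]
      have hN2 : N ^ 2 ≤ (100 * L * (1 + t)) ^ 2 := sq_le_sq' (by linarith [abs_le.1 hNb]) (abs_le.1 hNb).2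
      have key := mul_le_mul_of_nonneg_left (hX' t ht (w / q ^ 4)) (pow_pos q0 4).le
      have k2 : q ^ 4 * (w / q ^ 4 * a t - (w / q ^ 4) ^ 2 / 2 * (M * (1 + t)))
          = w * a t - w ^ 2 / q ^ 4 / 2 * (M * (1 + t)) := by field_simp
      rw [k2] at key
      have k3 : w ^ 2 / q ^ 4 / 2 * (M * (1 + t)) ≤ 5000 * M / L ^ 2 * (1 / (1 + t)) := by
        have : w ^ 2 / q ^ 4 = N ^ 2 / (L ^ 4 * (1 + t) ^ 4) := by rw [hwe]; field_simp
        rw [this]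
        calc N ^ 2 / (L ^ 4 * (1 + t) ^ 4) / 2 * (M * (1 + t))
            ≤ (100 * L * (1 + t)) ^ 2 / (L ^ 4 * (1 + t) ^ 4) / 2 * (M * (1 + t)) := by gcongr
          _ = _ := by field_simp; ring
      rw [hη0]
      have : w * a t = η2 t * a t - 2 * η1 t * a t := by rw [hw]; ring
      have e : (η1 t * X t + q ^ 4 * X' t) - (η2 t * a t + η1 t * (X t - 2 * a t))
          = q ^ 4 * X' t - w * a t := by rw [this]; ring
      rw [e]; linarith
  have hf := hmono ⟨le_refl 0, by linarith⟩ ⟨by linarith, le_refl t1⟩ (by linarith)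
  have z0 : Z 0 = X 0 := by simp [hZ, hη, hη1, hs]
  have z1 : Z t1 = 5000 * M / L := by
    have : s t1 = 1 := by rw [hs]; simp only; rw [← hL]; exact div_self hL0.ne'
    simp only [hZ, hη, hη1, this, ← hL]; field_simp; ring
  rw [z0, z1] at hf
  exact hf

lemma exp_abs_int (c : ℝ) : Integrable (fun x : ℝ => exp (-|x - c| / 2)) ∧ ∫ x : ℝ, exp (-|x - c| / 2) = 4 := by
  have h := integral_comp_abs (f := fun x => exp (-x / 2))
  have h2 : ∫ x in Ioi (0:ℝ), exp (-x / 2) = 2 := by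
    have := integral_exp_mul_Ioi (a := -1/2) (by norm_num) 0
    simp only [mul_zero, exp_zero] at this
    rw [show (fun x : ℝ => exp (-x / 2)) = fun x => exp (-1/2 * x) by ext x; congr 1; ring]
    rw [this]; norm_num
  have h3 : ∫ x : ℝ, exp (-|x| / 2) = 4 := by rw [h, h2]; norm_num
  have h4 : Integrable (fun x : ℝ => exp (-|x| / 2)) := by
    by_contra hh
    rw [integral_undef hh] at h3
    norm_num at h3
  exact ⟨h4.comp_sub_right c, by rw [integral_sub_right_eq_self (fun x => exp (-|x| / 2)) c, h3]⟩

lemma vol_bound (ω : E3) (hω : ‖ω‖ = 1) (R : ℝ) (hR : 0 < R) :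
    ∫ x in closedBall (0 : E3) R, exp ⟪ω, x⟫ ≤ 16 * π * R * exp R := by
  obtain ⟨b, hb⟩ := Orthonormal.exists_orthonormalBasis_extension_of_card_eq (𝕜 := ℝ) (E := E3)
    (ι := Fin 3) (by simp) (v := fun _ => ω) (s := {0}) (by
      constructor
      · intro i; simpa using hω
      · intro i j hij; exact absurd (Subsingleton.elim i j) hij)
  have hb0 : b 0 = ω := hb 0 rfl
  set k : Fin 3 → ℝ → ℝ := fun i s => if i = 0 then exp (-|s - R| / 2) else exp (-(1 / (4 * R)) * s ^ 2) with hk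
  have ki : ∀ i, Integrable (k i) := by
    intro i
    by_cases h : i = 0
    · simp only [hk, h, if_true]; exact (exp_abs_int R).1
    · simp only [hk, h, if_false]; exact integrable_exp_neg_mul_sq (by positivity)
  have kp : ∀ i s, 0 ≤ k i s := by
    intro i s; simp only [hk]; split_ifs <;> positivity
  have hprod : ∫ y : Fin 3 → ℝ, ∏ i, k i (y i) = 16 * π * R := by
    rw [integral_fintype_prod_volume_eq_prod, Fin.prod_univ_three]
    simp only [hk, if_true, show (1 : Fin 3) ≠ 0 by decide, show (2 : Fin 3) ≠ 0 by decide, if_false]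
    rw [(exp_abs_int R).2, integral_gaussian, mul_assoc, mul_self_sqrt (by positivity)]
    field_simp; ring
  have hpi : Integrable (fun y : Fin 3 → ℝ => ∏ i, k i (y i)) := Integrable.fintype_prod ki
  have mp := (EuclideanSpace.volume_preserving_symm_measurableEquiv_toLp (Fin 3)).comp b.measurePreserving_repr
  have me : MeasurableEmbedding ((MeasurableEquiv.toLp 2 (Fin 3 → ℝ)).symm ∘ b.repr) :=
    (MeasurableEquiv.measurableEmbedding _).comp b.repr.toHomeomorph.measurableEmbedding
  have h1 := mp.integral_comp me (fun y : Fin 3 → ℝ => ∏ i, k i (y i))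
  have h2 := (mp.integrable_comp_emb me (g := fun y : Fin 3 → ℝ => ∏ i, k i (y i))).2 hpi
  have hpt : ∀ x ∈ closedBall (0 : E3) R, exp ⟪ω, x⟫ ≤ exp R * ∏ i, k i (b.repr x i) := by
    intro x hx
    have hn : ‖x‖ ≤ R := by simpa using hx
    have hs : ‖x‖ ^ 2 = b.repr x 0 ^ 2 + b.repr x 1 ^ 2 + b.repr x 2 ^ 2 := by
      rw [← b.repr.norm_map x, EuclideanSpace.norm_sq_eq, Fin.sum_univ_three]; simp
    have hi : ⟪ω, x⟫ = b.repr x 0 := by rw [b.repr_apply_apply, hb0]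
    have hle : b.repr x 0 ≤ R := by
      rw [← hi]; calc ⟪ω, x⟫ ≤ ‖ω‖ * ‖x‖ := real_inner_le_norm _ _
        _ ≤ R := by rw [hω]; linarith
    rw [Fin.prod_univ_three, hi]
    simp only [hk, if_true, show (1 : Fin 3) ≠ 0 by decide, show (2 : Fin 3) ≠ 0 by decide, if_false]
    rw [← exp_add, ← exp_add, ← exp_add]
    apply exp_le_exp.2
    rw [abs_of_nonpos (by linarith)]
    generalize b.repr x 0 = p at *
    generalize b.repr x 1 = q at *
    generalize b.repr x 2 = r at *
    have : q ^ 2 + r ^ 2 ≤ 2 * R * (R - p) := by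
      have : ‖x‖ ^ 2 ≤ R ^ 2 := by gcongr
      nlinarith [sq_nonneg (R - p)]
    have h3 : 1 / (4 * R) * (q ^ 2 + r ^ 2) ≤ (R - p) / 2 := by
      rw [div_mul_eq_mul_div, div_le_iff₀ (by positivity)]; linarith
    linarith
  have hci : IntegrableOn (fun x : E3 => exp ⟪ω, x⟫) (closedBall 0 R) :=
    (Continuous.continuousOn (by fun_prop)).integrableOn_compact (isCompact_closedBall _ _)
  calc ∫ x in closedBall (0 : E3) R, exp ⟪ω, x⟫
      ≤ ∫ x in closedBall (0 : E3) R, exp R * ∏ i, k i (b.repr x i) :=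
        setIntegral_mono_on hci (h2.const_mul _).integrableOn measurableSet_closedBall hpt
    _ ≤ ∫ x : E3, exp R * ∏ i, k i (b.repr x i) :=
        setIntegral_le_integral (h2.const_mul _) (Filter.Eventually.of_forall fun x =>
          mul_nonneg (exp_pos _).le (Finset.prod_nonneg fun i _ => kp _ _))
    _ = exp R * (16 * π * R) := by rw [integral_const_mul, ← hprod, ← h1]; rfl
    _ = _ := by ring

lemma compact_supp_of {f : E3 → ℝ} {R : ℝ} (h : ∀ x, R < ‖x‖ → f x = 0) : HasCompactSupport f :=
  HasCompactSupport.intro (isCompact_closedBall (0 : E3) R) (fun x hx => h x (by simpa using hx))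

lemma parts_exp (ω : E3) (g : E3 → ℝ) (hg : ContDiff ℝ 1 g) (hs : HasCompactSupport g) (i : Fin 3) :
    Integrable (fun x => exp ⟪ω, x⟫ * pdv i g x) ∧
    Integrable (fun x => exp ⟪ω, x⟫ * (ω i * g x)) ∧
    ∫ x, exp ⟪ω, x⟫ * pdv i g x = - ∫ x, exp ⟪ω, x⟫ * (ω i * g x) := by
  have hd : ∀ x : E3, HasFDerivAt (fun x : E3 => exp ⟪ω, x⟫) (exp ⟪ω, x⟫ • innerSL ℝ ω) x := by
    intro x
    exact ((innerSL ℝ ω).hasFDerivAt (x := x)).exp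
  have hf : ∀ x : E3, fderiv ℝ (fun x : E3 => exp ⟪ω, x⟫) x (EuclideanSpace.single i 1) = exp ⟪ω, x⟫ * ω i := by
    intro x
    rw [(hd x).fderiv]
    simp [EuclideanSpace.inner_single_right]
  have hgc := hg.continuous
  have hg' : Continuous (fun x => fderiv ℝ g x (EuclideanSpace.single i 1)) :=
    (hg.continuous_fderiv (by norm_num)).clm_apply continuous_const
  have hs' : HasCompactSupport (fun x => fderiv ℝ g x (EuclideanSpace.single i 1)) :=
    hs.fderiv_apply ℝ _
  have i1 : Integrable (fun x => exp ⟪ω, x⟫ * pdv i g x) := by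
    refine Continuous.integrable_of_hasCompactSupport ?_ ?_
    · exact Continuous.mul (by fun_prop) hg'
    · exact hs'.mul_left
  have i2 : Integrable (fun x => exp ⟪ω, x⟫ * (ω i * g x)) := by
    refine Continuous.integrable_of_hasCompactSupport (by fun_prop) ?_
    exact (HasCompactSupport.mul_left hs).mul_left
  have i3 : Integrable (fun x => exp ⟪ω, x⟫ * g x) := by
    refine Continuous.integrable_of_hasCompactSupport (by fun_prop) hs.mul_left
  refine ⟨i1, i2, ?_⟩
  have := integral_mul_fderiv_eq_neg_fderiv_mul_of_integrable (μ := (volume : Measure E3))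
    (f := fun x : E3 => exp ⟪ω, x⟫) (g := g) (v := EuclideanSpace.single i 1) (by
      simp_rw [hf, mul_assoc]; exact i2) i1 i3 (fun x _ => (hd x).differentiableAt)
      (fun x _ => hg.differentiable (by norm_num) x)
  simp_rw [hf, mul_assoc] at this
  exact this

lemma deriv_int (ω : E3) (O : Set ℝ) (hO : IsOpen O) (f : ℝ → E3 → ℝ) (g : Fin 3 → ℝ → E3 → ℝ)
    (hf : ContDiffOn ℝ 1 (fun p : ℝ × E3 => f p.1 p.2) (O ×ˢ univ))
    (hfs : ∀ t ∈ O, ∀ x, 1 + t < ‖x‖ → f t x = 0)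
    (hg : ∀ i, ∀ t ∈ O, ContDiff ℝ 1 (g i t))
    (hgs : ∀ i, ∀ t ∈ O, ∀ x, 1 + t < ‖x‖ → g i t x = 0)
    (heq : ∀ t ∈ O, ∀ x, deriv (fun s => f s x) t + ∑ i, pdv i (g i t) x = 0)
    (t : ℝ) (ht : t ∈ O) :
    HasDerivAt (fun t => ∫ x, exp ⟪ω, x⟫ * f t x) (∫ x, exp ⟪ω, x⟫ * ∑ i, ω i * g i t x) t := by
  have hOO : IsOpen (O ×ˢ (univ : Set E3)) := hO.prod isOpen_univ
  set F : ℝ × E3 → ℝ := fun p => f p.1 p.2 with hF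
  have hda : ∀ s ∈ O, ∀ x, HasDerivAt (fun s => f s x) (fderiv ℝ F (s, x) (1, 0)) s := by
    intro s hs x
    have h1 : HasFDerivAt F (fderiv ℝ F (s, x)) (s, x) :=
      ((hf.contDiffAt (hOO.mem_nhds ⟨hs, mem_univ _⟩)).differentiableAt (by norm_num)).hasFDerivAt
    have h2 : HasDerivAt (fun s : ℝ => (s, x)) ((1 : ℝ), (0 : E3)) s :=
      (hasDerivAt_id s).prodMk (hasDerivAt_const s x)
    exact h1.comp_hasDerivAt s h2
  have hdc : ContinuousOn (fun p : ℝ × E3 => fderiv ℝ F p (1, 0)) (O ×ˢ univ) :=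
    (hf.continuousOn_fderiv_of_isOpen hOO (by norm_num)).clm_apply continuousOn_const
  obtain ⟨δ, hδ, hball⟩ := Metric.nhds_basis_closedBall.mem_iff.1 (hO.mem_nhds ht)
  set K : Set (ℝ × E3) := closedBall t δ ×ˢ closedBall 0 (2 + t + δ) with hK
  have hKc : IsCompact K := (isCompact_closedBall _ _).prod (isCompact_closedBall _ _)
  have hc2 : ContinuousOn (fun p : ℝ × E3 => exp ⟪ω, p.2⟫ * fderiv ℝ F p (1, 0)) (O ×ˢ univ) :=
    ContinuousOn.mul (Continuous.continuousOn (by fun_prop)) hdc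
  obtain ⟨M, hM⟩ := hKc.exists_bound_of_continuousOn
    (hc2.mono (prod_mono hball (subset_univ _)))
  have hsl : ∀ s ∈ O, ContinuousOn (fun x : E3 => (s, x)) univ ∧
      MapsTo (fun x : E3 => (s, x)) univ (O ×ˢ univ) := fun s hs =>
    ⟨Continuous.continuousOn (by fun_prop), fun x _ => ⟨hs, mem_univ _⟩⟩
  have hfc : ∀ s ∈ O, Continuous (fun x => exp ⟪ω, x⟫ * f s x) := by
    intro s hs
    have : Continuous (f s) := by
      rw [← continuousOn_univ]
      exact hf.continuousOn.comp (hsl s hs).1 (hsl s hs).2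
    fun_prop
  have hfc' : ∀ s ∈ O, Continuous (fun x => exp ⟪ω, x⟫ * fderiv ℝ F (s, x) (1, 0)) := by
    intro s hs
    have : Continuous (fun x => fderiv ℝ F (s, x) (1, 0)) := by
      rw [← continuousOn_univ]
      exact ContinuousOn.comp (g := fun p : ℝ × E3 => fderiv ℝ F p (1, 0)) hdc (hsl s hs).1 (hsl s hs).2
    fun_prop
  have main := hasDerivAt_integral_of_dominated_loc_of_deriv_le (μ := (volume : Measure E3))
    (F := fun s x => exp ⟪ω, x⟫ * f s x) (F' := fun s x => exp ⟪ω, x⟫ * fderiv ℝ F (s, x) (1, 0))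
    (x₀ := t) (s := ball t δ) (bound := (closedBall (0 : E3) (2 + t + δ)).indicator (fun _ => M))
    (ball_mem_nhds t hδ) ?_ ?_ ?_ ?_ ?_ ?_
  · refine HasDerivAt.congr_deriv main.2 ?_
    have e : ∀ x, exp ⟪ω, x⟫ * fderiv ℝ F (t, x) (1, 0) = - ∑ i, exp ⟪ω, x⟫ * pdv i (g i t) x := by
      intro x
      have := heq t ht x
      rw [(hda t ht x).deriv] at this
      rw [← Finset.mul_sum]
      rw [eq_neg_of_add_eq_zero_left this]; ring
    have hp := fun i => parts_exp ω (g i t) (hg i t ht) (compact_supp_of (hgs i t ht)) i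
    simp_rw [e]
    rw [integral_neg, integral_finsetSum _ (fun i _ => (hp i).1)]
    simp_rw [Finset.mul_sum]
    rw [integral_finsetSum _ (fun i _ => (hp i).2.1), ← Finset.sum_neg_distrib]
    refine Finset.sum_congr rfl fun i _ => ?_
    rw [(hp i).2.2, neg_neg]
  · filter_upwards [hO.mem_nhds ht] with s hs
    exact (hfc s hs).aestronglyMeasurable
  · exact (hfc t ht).integrable_of_hasCompactSupport (HasCompactSupport.mul_left (compact_supp_of (hfs t ht)))
  · exact (hfc' t ht).aestronglyMeasurable
  · refine Filter.Eventually.of_forall fun x s hs => ?_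
    have hsO : s ∈ O := hball (ball_subset_closedBall hs)
    by_cases hx : x ∈ closedBall (0 : E3) (2 + t + δ)
    · rw [indicator_of_mem hx]
      exact hM (s, x) ⟨ball_subset_closedBall hs, hx⟩
    · rw [indicator_of_notMem hx]
      have : fderiv ℝ F (s, x) (1, 0) = 0 := by
        rw [← (hda s hsO x).deriv]
        have : (fun s => f s x) =ᶠ[nhds s] fun _ => 0 := by
          filter_upwards [isOpen_ball.mem_nhds hs] with r hr
          refine hfs r (hball (ball_subset_closedBall hr)) x ?_
          have h1 : 2 + t + δ < ‖x‖ := by simpa using hx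
          have h2 : |r - t| < δ := by simpa [Real.dist_eq] using hr
          linarith [(abs_lt.1 h2).2]
        rw [this.deriv_eq]; simp
      simp [this]
  · rw [integrable_indicator_iff measurableSet_closedBall]
    exact integrableOn_const (isCompact_closedBall _ _).measure_ne_top
  · refine Filter.Eventually.of_forall fun x s hs => ?_
    exact (hda s (hball (ball_subset_closedBall hs)) x).const_mul _

lemma omega_bound (T : ℝ≥0∞) (ρ : ℝ → E3 → ℝ) (u : ℝ → E3 → E3) (hsol : IsEulerSolution T ρ u)
    (hρs : ∀ t ∈ timeSet T, Function.support (fun x => ρ t x - 1) ⊆ closedBall 0 (1 + t))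
    (hus : ∀ t ∈ timeSet T, Function.support (u t) ⊆ closedBall 0 (1 + t))
    (t1 : ℝ) (h1 : 1 ≤ t1) (ht1 : ENNReal.ofReal t1 < T) (ω : E3) (hω : ‖ω‖ = 1) :
    (∫ x, exp ⟪ω, x⟫ * (ρ 0 x - 1)) + (∫ x, exp ⟪ω, x⟫ * ∑ j, ω j * (ρ 0 x * u 0 x j))
      ≤ 5000 * (16 * π * exp 1) / log (1 + t1) := by
  set O : Set ℝ := {t : ℝ | 0 < t ∧ ENNReal.ofReal t < T} with hOdef
  have hO : IsOpen O := by
    have : O = Ioi 0 ∩ ENNReal.ofReal ⁻¹' (Iio T) := rfl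
    rw [this]
    exact isOpen_Ioi.inter (isOpen_Iio.preimage ENNReal.continuous_ofReal)
  have hOS : O ⊆ timeSet T := fun t ht => ⟨ht.1.le, ht.2⟩
  have hOn : ∀ t ∈ O, timeSet T ∈ nhds t := fun t ht =>
    Filter.mem_of_superset (hO.mem_nhds ht) hOS
  have hIcc : Icc 0 t1 ⊆ timeSet T := fun t ht =>
    ⟨ht.1, (ENNReal.ofReal_le_ofReal ht.2).trans_lt ht1⟩
  have hIoo : Ioo 0 t1 ⊆ O := fun t ht => ⟨ht.1, (hIcc (Ioo_subset_Icc_self ht)).2⟩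
  have hρ0 : ∀ t ∈ timeSet T, ∀ x, 1 + t < ‖x‖ → ρ t x = 1 := by
    intro t ht x hx
    by_contra h
    have := hρs t ht (a := x) (by simpa [sub_eq_zero] using h)
    simp at this; linarith
  have hu0 : ∀ t ∈ timeSet T, ∀ x, 1 + t < ‖x‖ → u t x = 0 := by
    intro t ht x hx
    by_contra h
    have := hus t ht (a := x) (by simpa using h)
    simp at this; linarith
  -- joint regularity
  have cρ := hsol.contDiff_rho
  have cu : ∀ j, ContDiffOn ℝ 1 (fun p : ℝ × E3 => u p.1 p.2 j) (timeSet T ×ˢ univ) := fun j =>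
    (contDiff_piLp_apply (p := 2) (i := j)).comp_contDiffOn hsol.contDiff_u
  set f1 : ℝ → E3 → ℝ := fun t x => ρ t x - 1 with hf1
  set f2 : ℝ → E3 → ℝ := fun t x => ∑ j, ω j * (ρ t x * u t x j) with hf2
  set g1 : Fin 3 → ℝ → E3 → ℝ := fun i t x => ρ t x * u t x i with hg1
  set g2 : Fin 3 → ℝ → E3 → ℝ := fun i t x =>
    ∑ j, ω j * (ρ t x * u t x i * u t x j) + ω i * (ρ t x ^ 2 / 2 - 1 / 2) with hg2
  have cf1 : ContDiffOn ℝ 1 (fun p : ℝ × E3 => f1 p.1 p.2) (timeSet T ×ˢ univ) :=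
    cρ.sub contDiffOn_const
  have cf2 : ContDiffOn ℝ 1 (fun p : ℝ × E3 => f2 p.1 p.2) (timeSet T ×ˢ univ) :=
    ContDiffOn.sum fun j _ => contDiffOn_const.mul (cρ.mul (cu j))
  have hOm : O ×ˢ (univ : Set E3) ⊆ timeSet T ×ˢ univ := prod_mono hOS (subset_refl _)
  -- slices
  have sl : ∀ t ∈ timeSet T, ∀ F : ℝ × E3 → ℝ, ContDiffOn ℝ 1 F (timeSet T ×ˢ univ) →
      ContDiff ℝ 1 (fun x => F (t, x)) := by
    intro t ht F hF
    rw [← contDiffOn_univ]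
    exact hF.comp (contDiff_const.prodMk contDiff_id).contDiffOn (fun x _ => ⟨ht, mem_univ _⟩)
  have sρ : ∀ t ∈ timeSet T, ContDiff ℝ 1 (ρ t) := fun t ht => sl t ht _ cρ
  have su : ∀ t ∈ timeSet T, ∀ j, ContDiff ℝ 1 (fun x => u t x j) := fun t ht j => sl t ht _ (cu j)
  have sf1 : ∀ t ∈ timeSet T, ContDiff ℝ 1 (f1 t) := fun t ht => sl t ht _ cf1
  have sg1 : ∀ i, ∀ t ∈ timeSet T, ContDiff ℝ 1 (g1 i t) := fun i t ht => (sρ t ht).mul (su t ht i)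
  have sg2 : ∀ i, ∀ t ∈ timeSet T, ContDiff ℝ 1 (g2 i t) := fun i t ht =>
    (ContDiff.sum fun j _ => contDiff_const.mul (((sρ t ht).mul (su t ht i)).mul (su t ht j))).add
      (contDiff_const.mul ((((sρ t ht).pow 2).div_const 2).sub contDiff_const))
  -- time slices
  have tsl : ∀ t ∈ O, ∀ x, ∀ F : ℝ × E3 → ℝ, ContDiffOn ℝ 1 F (timeSet T ×ˢ univ) →
      DifferentiableAt ℝ (fun s => F (s, x)) t := by
    intro t ht x F hF
    have h := (hF.mono hOm).contDiffAt ((hO.prod isOpen_univ).mem_nhds (x := (t, x)) ⟨ht, mem_univ _⟩)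
    exact (h.differentiableAt (by norm_num)).comp t
      (DifferentiableAt.prodMk differentiableAt_id (differentiableAt_const x))
  have zf1 : ∀ t ∈ timeSet T, ∀ x, 1 + t < ‖x‖ → f1 t x = 0 := by
    intro t ht x hx; simp [hf1, hρ0 t ht x hx]
  have zf2 : ∀ t ∈ timeSet T, ∀ x, 1 + t < ‖x‖ → f2 t x = 0 := by
    intro t ht x hx; simp [hf2, hu0 t ht x hx]
  have zg1 : ∀ i, ∀ t ∈ timeSet T, ∀ x, 1 + t < ‖x‖ → g1 i t x = 0 := by
    intro i t ht x hx; simp [hg1, hu0 t ht x hx]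
  have zg2 : ∀ i, ∀ t ∈ timeSet T, ∀ x, 1 + t < ‖x‖ → g2 i t x = 0 := by
    intro i t ht x hx; simp [hg2, hu0 t ht x hx, hρ0 t ht x hx]
  have e1 : ∀ t ∈ O, ∀ x, deriv (fun s => f1 s x) t + ∑ i, pdv i (g1 i t) x = 0 := by
    intro t ht x
    have := hsol.mass t (hOS ht) x
    rw [derivWithin_of_mem_nhds (hOn t ht)] at this
    rw [hf1]; simp only [deriv_sub_const_fun]
    exact this
  have e2 : ∀ t ∈ O, ∀ x, deriv (fun s => f2 s x) t + ∑ i, pdv i (g2 i t) x = 0 := by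
    intro t ht x
    have hm := fun j => hsol.momentum t (hOS ht) x j
    simp_rw [derivWithin_of_mem_nhds (hOn t ht)] at hm
    have d1 : deriv (fun s => f2 s x) t = ∑ j, ω j * deriv (fun s => ρ s x * u s x j) t := by
      apply HasDerivAt.deriv
      rw [hf2]
      refine HasDerivAt.fun_sum fun j _ => HasDerivAt.const_mul _ ?_
      exact (tsl t ht x _ (cρ.mul (cu j))).hasDerivAt
    have d2 : ∀ i, pdv i (g2 i t) x = ∑ j, ω j * pdv i (fun y => ρ t y * u t y i * u t y j) x
        + ω i * pdv i (fun y => ρ t y ^ 2 / 2) x := by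
      intro i
      have hS := hOS ht
      have q1 : ∀ j, HasFDerivAt (fun y => ρ t y * u t y i * u t y j) _ x := fun j =>
        ((((sρ t hS).mul (su t hS i)).mul (su t hS j)).differentiable (by norm_num) x).hasFDerivAt
      have q2 : HasFDerivAt (fun y => ρ t y ^ 2 / 2) _ x :=
        ((((sρ t hS).pow 2).div_const 2).differentiable (by norm_num) x).hasFDerivAt
      have q3 : HasFDerivAt (g2 i t) _ x :=
        (HasFDerivAt.fun_sum fun j (_ : j ∈ Finset.univ) => (q1 j).const_mul (ω j)).add
          ((q2.sub_const (1 / 2)).const_mul (ω i))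
      unfold pdv
      rw [q3.fderiv]
      simp
    rw [d1]
    simp_rw [d2]
    have hz : ∑ j, ω j * (deriv (fun s => ρ s x * u s x j) t
        + ∑ i, pdv i (fun y => ρ t y * u t y i * u t y j) x
        + pdv j (fun y => ρ t y ^ 2 / 2) x) = 0 :=
      Finset.sum_eq_zero fun j _ => by rw [hm j, mul_zero]
    rw [← hz]
    simp only [Fin.sum_univ_three]
    ring
  set A : ℝ → ℝ := fun t => ∫ x, exp ⟪ω, x⟫ * f1 t x with hA
  set B : ℝ → ℝ := fun t => ∫ x, exp ⟪ω, x⟫ * f2 t x with hB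
  set D : ℝ → ℝ := fun t => ∫ x, exp ⟪ω, x⟫ * ∑ i, ω i * g2 i t x with hD
  have dA : ∀ t ∈ O, HasDerivAt A (B t) t := by
    intro t ht
    exact deriv_int ω O hO f1 g1 (cf1.mono hOm) (fun t ht => zf1 t (hOS ht))
      (fun i t ht => sg1 i t (hOS ht)) (fun i t ht => zg1 i t (hOS ht)) e1 t ht
  have dB : ∀ t ∈ O, HasDerivAt B (D t) t := by
    intro t ht
    exact deriv_int ω O hO f2 g2 (cf2.mono hOm) (fun t ht => zf2 t (hOS ht))
      (fun i t ht => sg2 i t (hOS ht)) (fun i t ht => zg2 i t (hOS ht)) e2 t ht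
  have cont : ∀ f : ℝ → E3 → ℝ, ContDiffOn ℝ 1 (fun p : ℝ × E3 => f p.1 p.2) (timeSet T ×ˢ univ) →
      (∀ t ∈ timeSet T, ∀ x, 1 + t < ‖x‖ → f t x = 0) →
      ContinuousOn (fun t => ∫ x, exp ⟪ω, x⟫ * f t x) (Icc 0 t1) := by
    intro f hf hz
    refine continuousOn_integral_of_compact_support (isCompact_closedBall (0 : E3) (1 + t1)) ?_ ?_
    · exact ContinuousOn.mul (Continuous.continuousOn (by fun_prop))
        (hf.continuousOn.mono (prod_mono hIcc (subset_refl _)))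
    · intro t x ht hx
      have : 1 + t1 < ‖x‖ := by simpa using hx
      rw [hz t (hIcc ht) x (by linarith [ht.2]), mul_zero]
  have cA : ContinuousOn A (Icc 0 t1) := cont f1 cf1 zf1
  have cB : ContinuousOn B (Icc 0 t1) := cont f2 cf2 zf2
  have hDb : ∀ t ∈ O, ∀ b : ℝ,
      (1 + b) * A t - b ^ 2 / 2 * (16 * π * (1 + t) * exp (1 + t)) ≤ D t := by
    intro t ht b
    have hS := hOS ht
    have i1 : Integrable (fun x => exp ⟪ω, x⟫ * f1 t x) := by
      have := (sf1 t hS).continuous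
      exact Continuous.integrable_of_hasCompactSupport (by fun_prop)
        (HasCompactSupport.mul_left (compact_supp_of (zf1 t hS)))
    have i2 : Integrable (fun x => exp ⟪ω, x⟫ * ∑ i, ω i * g2 i t x) := by
      have := fun i => (sg2 i t hS).continuous
      refine Continuous.integrable_of_hasCompactSupport (by fun_prop)
        (HasCompactSupport.mul_left (compact_supp_of (R := 1 + t) fun x hx => ?_))
      exact Finset.sum_eq_zero fun i _ => by rw [zg2 i t hS x hx, mul_zero]
    have i3 : IntegrableOn (fun x : E3 => exp ⟪ω, x⟫) (closedBall 0 (1 + t)) :=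
      (Continuous.continuousOn (by fun_prop)).integrableOn_compact (isCompact_closedBall _ _)
    have i4 := (integrable_indicator_iff measurableSet_closedBall).2 i3
    have hv := vol_bound ω hω (1 + t) (by linarith [ht.1])
    rw [← integral_indicator measurableSet_closedBall] at hv
    have hle : ∫ x, ((1 + b) * (exp ⟪ω, x⟫ * f1 t x)
        - b ^ 2 / 2 * (closedBall (0 : E3) (1 + t)).indicator (fun x => exp ⟪ω, x⟫) x) ≤ D t := by
      refine integral_mono ((i1.const_mul _).sub (i4.const_mul _)) i2 fun x => ?_
      simp only
      have hw : ω 0 ^ 2 + ω 1 ^ 2 + ω 2 ^ 2 = 1 := by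
        have := EuclideanSpace.norm_sq_eq ω
        rw [hω, Fin.sum_univ_three] at this
        simp at this; linarith
      by_cases hx : x ∈ closedBall (0 : E3) (1 + t)
      · rw [indicator_of_mem hx]
        have hkey : (1 + b) * f1 t x - b ^ 2 / 2 ≤ ∑ i, ω i * g2 i t x := by
          have : ∑ i, ω i * g2 i t x = ρ t x * (ω 0 * u t x 0 + ω 1 * u t x 1 + ω 2 * u t x 2) ^ 2
              + (ω 0 ^ 2 + ω 1 ^ 2 + ω 2 ^ 2) * (ρ t x ^ 2 / 2 - 1 / 2) := by
            simp only [hg2, Fin.sum_univ_three]; ring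
          rw [this, hw]
          have hp := mul_nonneg (hsol.rho_pos t hS x).le
            (sq_nonneg (ω 0 * u t x 0 + ω 1 * u t x 1 + ω 2 * u t x 2))
          simp only [hf1]
          nlinarith [sq_nonneg (ρ t x - 1 - b)]
        have := mul_le_mul_of_nonneg_left hkey (exp_pos ⟪ω, x⟫).le
        linarith
      · rw [indicator_of_notMem hx]
        have hx' : 1 + t < ‖x‖ := by simpa using hx
        rw [zf1 t hS x hx', Finset.sum_eq_zero fun i _ => by rw [zg2 i t hS x hx', mul_zero]]
        simp
    rw [integral_sub (i1.const_mul _) (i4.const_mul _), integral_const_mul, integral_const_mul] at hle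
    have := mul_le_mul_of_nonneg_left hv (show 0 ≤ b ^ 2 / 2 by positivity)
    linarith
  have dE : ∀ t : ℝ, HasDerivAt (fun t => exp (-t)) (-exp (-t)) t := fun t => by
    simpa using (hasDerivAt_neg t).exp
  have cE : ContinuousOn (fun t : ℝ => exp (-t)) (Icc 0 t1) := Continuous.continuousOn (by fun_prop)
  have fin := ode_bound (16 * π * exp 1) (by positivity) t1 h1
    (fun t => exp (-t) * A t) (fun t => exp (-t) * (A t + B t)) (fun t => exp (-t) * (D t - A t))
    (cE.mul cA) (cE.mul (cA.add cB)) ?_ ?_ ?_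
  · simpa using fin
  · intro t ht
    refine ((dE t).mul (dA t (hIoo ht))).congr_deriv ?_
    ring
  · intro t ht
    refine ((dE t).mul ((dA t (hIoo ht)).add (dB t (hIoo ht)))).congr_deriv ?_
    simp only [Pi.add_apply]; ring
  · intro t ht b
    have h := mul_le_mul_of_nonneg_left (hDb t (hIoo ht) b) (exp_pos (-t)).le
    have e : exp (-t) * exp (1 + t) = exp 1 := by rw [← exp_add]; congr 1; ring
    have : exp (-t) * ((1 + b) * A t - b ^ 2 / 2 * (16 * π * (1 + t) * exp (1 + t)))
        = exp (-t) * ((1 + b) * A t) - b ^ 2 / 2 * (16 * π * (1 + t)) * (exp (-t) * exp (1 + t)) := by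
      ring
    rw [this, e] at h
    linarith

lemma swap_int (h : E3 × sphere (0 : E3) 1 → ℝ) (hc : Continuous h)
    (hz : ∀ x ω, 1 < ‖x‖ → h (x, ω) = 0) :
    Integrable (fun ω => ∫ x, h (x, ω)) sphμ ∧
    ∫ x : E3, ∫ ω, h (x, ω) ∂sphμ = ∫ ω, (∫ x : E3, h (x, ω)) ∂sphμ := by
  have : IsFiniteMeasure sphμ := by unfold sphμ; infer_instance
  have hi : Integrable h ((volume : Measure E3).prod sphμ) := by
    refine hc.integrable_of_hasCompactSupport ?_
    refine HasCompactSupport.intro ((isCompact_closedBall (0 : E3) 1).prod isCompact_univ) ?_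
    rintro ⟨x, ω⟩ hx
    refine hz x ω ?_
    by_contra hh
    exact hx ⟨by simpa using hh, mem_univ _⟩
  exact ⟨hi.integral_prod_right, integral_integral_swap (f := fun x ω => h (x, ω)) hi⟩

/-- Sideris' theorem (small-data version): if the initial data satisfy
`ε := ∫∫ e^{ω·x} ρ₀ + ∫∫ e^{ω·x} (1+ρ₀)(u₀·ω) > 0`, then the lifespan of the classical
solution of the 3D compressible Euler equations satisfies `T ≤ e^{C/ε}` for a universal
constant `C > 0`; in particular `T < ∞`. -/
theorem euler_blowup :
    ∃ C > (0 : ℝ),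
      ∀ (T : ℝ≥0∞) (ρ : ℝ → E3 → ℝ) (u : ℝ → E3 → E3) (ρ₀ : E3 → ℝ) (u₀ : E3 → E3) (ε : ℝ),
        0 < T →
        ContDiff ℝ (⊤ : ℕ∞) ρ₀ → ContDiff ℝ (⊤ : ℕ∞) u₀ →
        Function.support ρ₀ ⊆ closedBall 0 1 →
        Function.support u₀ ⊆ closedBall 0 1 →
        (∀ x, ρ 0 x = 1 + ρ₀ x) → (∀ x, u 0 x = u₀ x) →
        IsEulerSolution T ρ u →
        (∀ t ∈ timeSet T, Function.support (fun x => ρ t x - 1) ⊆ closedBall 0 (1 + t)) →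
        (∀ t ∈ timeSet T, Function.support (u t) ⊆ closedBall 0 (1 + t)) →
        ε = (∫ x : E3, ∫ ω : sphere (0 : E3) 1, exp ⟪(ω : E3), x⟫ * ρ₀ x ∂sphμ)
            + (∫ x : E3, ∫ ω : sphere (0 : E3) 1,
                exp ⟪(ω : E3), x⟫ * (1 + ρ₀ x) * ⟪u₀ x, (ω : E3)⟫ ∂sphμ) →
        0 < ε →
        T ≤ ENNReal.ofReal (exp (C / ε)) := by
  set K : ℝ := 5000 * (16 * π * exp 1) with hK
  have : IsFiniteMeasure sphμ := by unfold sphμ; infer_instance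
  have hK0 : 0 < K := by positivity
  set c : ℝ := sphμ.real univ with hc
  have hc0 : 0 ≤ c := measureReal_nonneg
  refine ⟨c * K + 1, by positivity, ?_⟩
  intro T ρ u ρ₀ u₀ ε hT hρ₀ hu₀ hsρ hsu iρ iu hsol hρs hus hε hpos
  by_contra hcon
  rw [not_le] at hcon
  set t1 : ℝ := exp ((c * K + 1) / ε) with ht1
  have h1 : 1 ≤ t1 := one_le_exp (by positivity)
  have hL : (c * K + 1) / ε < log (1 + t1) := by
    calc (c * K + 1) / ε = log t1 := by rw [ht1, log_exp]
      _ < log (1 + t1) := log_lt_log (exp_pos _) (by linarith)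
  have hL0 : 0 < log (1 + t1) := lt_of_le_of_lt (by positivity) hL
  have zρ : ∀ x, 1 < ‖x‖ → ρ₀ x = 0 := by
    intro x hx
    by_contra h
    have := hsρ (a := x) (by simpa using h)
    simp at this; linarith
  have zu : ∀ x, 1 < ‖x‖ → u₀ x = 0 := by
    intro x hx
    by_contra h
    have := hsu (a := x) (by simpa using h)
    simp at this; linarith
  have kρ := hρ₀.continuous
  have ku := hu₀.continuous
  obtain ⟨j1, s1⟩ := swap_int (fun p => exp ⟪(p.2 : E3), p.1⟫ * ρ₀ p.1) (by fun_prop)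
    (fun x ω hx => by simp [zρ x hx])
  obtain ⟨j2, s2⟩ := swap_int
    (fun p => exp ⟪(p.2 : E3), p.1⟫ * (1 + ρ₀ p.1) * ⟪u₀ p.1, (p.2 : E3)⟫) (by fun_prop)
    (fun x ω hx => by simp [zu x hx])
  simp only at j1 j2 s1 s2
  rw [s1, s2, ← integral_add j1 j2] at hε
  have hb : ∀ ω : sphere (0 : E3) 1, (∫ x, exp ⟪(ω : E3), x⟫ * ρ₀ x)
      + (∫ x, exp ⟪(ω : E3), x⟫ * (1 + ρ₀ x) * ⟪u₀ x, (ω : E3)⟫) ≤ K / log (1 + t1) := by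
    intro ω
    have := omega_bound T ρ u hsol hρs hus t1 h1 hcon (ω : E3) (by simp)
    refine le_trans (le_of_eq ?_) this
    congr 1
    · congr 1; ext x; rw [iρ x]; ring
    · congr 1; ext x; rw [iρ x, iu x]
      simp only [PiLp.inner_apply, Fin.sum_univ_three]
      simp; ring
  have hle : ε ≤ c * (K / log (1 + t1)) := by
    rw [hε]
    refine (integral_mono (j1.add j2) (integrable_const (K / log (1 + t1))) hb).trans ?_
    rw [integral_const, smul_eq_mul]
  have h3 : ε * log (1 + t1) ≤ c * K := by
    rw [← mul_div_assoc, le_div_iff₀ hL0] at hle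
    exact hle
  rw [div_lt_iff₀ hpos] at hL
  linarith


end
end

section
/- Let (ρ, u) be a classical solution of the 3D compressible Euler equations with pressure p(ρ) = ρ²/2 on [0,T) × ℝ³ such that for each t, ρ(t,·) − 1 and u(t,·) are compactly supported. Then the function Y(t) = ∫_{ℝ³}∫_{S²} e^{ω·x} ρ(t,x)(u(t,x)·ω) dσ(ω) dx is differentiable and Y'(t) = ∫_{ℝ³}∫_{S²} e^{ω·x} ρ(t,x)(u(t,x)·ω)² dσ(ω) dx + (1/2) ∫_{ℝ³}∫_{S²} e^{ω·x} (ρ(t,x)² − 1) dσ(ω) dx for all t ∈ [0,T). -/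
open MeasureTheory Real Set Metric
open scoped ENNReal RealInnerProductSpace

noncomputable section

open Filter Topology

/-! ### Slices of `C¹` functions on `I × ℝ³` -/

/-- Directional derivative within `I × ℝ³`. -/
def DD (I : Set ℝ) (f : ℝ × E3 → ℝ) (v : ℝ × E3) (p : ℝ × E3) : ℝ :=
  fderivWithin ℝ f (I ×ˢ univ) p v

/-- The `i`-th spatial direction. -/
def ex (i : Fin 3) : ℝ × E3 := (0, EuclideanSpace.single i 1)

/-- The time direction. -/
def et : ℝ × E3 := (1, 0)

lemma timeSet_convex (T : ℝ≥0∞) : Convex ℝ (timeSet T) := by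
  apply Set.OrdConnected.convex
  constructor
  intro a ha b hb c hc
  exact ⟨ha.1.trans hc.1, lt_of_le_of_lt (ENNReal.ofReal_le_ofReal hc.2) hb.2⟩

lemma exists_later {T : ℝ≥0∞} {t : ℝ} (ht : t ∈ timeSet T) : ∃ t1 ∈ timeSet T, t < t1 := by
  obtain ⟨r, hr1, hr2⟩ := ENNReal.lt_iff_exists_real_btwn.1 ht.2
  obtain ⟨h1, h2⟩ := hr2
  have h3 : t < r := by
    by_contra h
    exact absurd (ENNReal.ofReal_le_ofReal (not_lt.1 h)) (not_le.2 h1)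
  exact ⟨r, ⟨hr1, h2⟩, h3⟩

lemma Icc_subset_timeSet {T : ℝ≥0∞} {t : ℝ} (ht : t ∈ timeSet T) : Icc 0 t ⊆ timeSet T :=
  fun _ hs => ⟨hs.1, lt_of_le_of_lt (ENNReal.ofReal_le_ofReal hs.2) ht.2⟩

lemma timeSet_uniqueDiff (T : ℝ≥0∞) : UniqueDiffOn ℝ (timeSet T) := by
  rcases (timeSet T).eq_empty_or_nonempty with h | ⟨t, ht⟩
  · rw [h]; exact uniqueDiffOn_empty
  · obtain ⟨t1, h1, h2⟩ := exists_later ht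
    apply uniqueDiffOn_convex (timeSet_convex T)
    have h0 : 0 < t1 := lt_of_le_of_lt ht.1 h2
    refine Set.Nonempty.mono (interior_mono (Icc_subset_timeSet h1)) ?_
    rw [interior_Icc]
    exact nonempty_Ioo.2 h0

section slices
variable {I : Set ℝ} {f g : ℝ × E3 → ℝ}

lemma hfd (hf : ContDiffOn ℝ 1 f (I ×ˢ univ)) {p : ℝ × E3} (hp : p.1 ∈ I) :
    HasFDerivWithinAt f (fderivWithin ℝ f (I ×ˢ univ) p) (I ×ˢ univ) p :=
  ((hf.differentiableOn (by norm_num)) p ⟨hp, mem_univ _⟩).hasFDerivWithinAt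

lemma slice_t (hf : ContDiffOn ℝ 1 f (I ×ˢ univ)) {s : ℝ} (hs : s ∈ I) (x : E3) :
    HasDerivWithinAt (fun s => f (s, x)) (DD I f et (s, x)) I s := by
  have h1 : HasDerivWithinAt (fun s : ℝ => (s, x)) ((1 : ℝ), (0 : E3)) I s :=
    ((hasDerivAt_id s).prodMk (hasDerivAt_const s x)).hasDerivWithinAt
  exact (hfd hf (p := (s, x)) hs).comp_hasDerivWithinAt s h1
    (show MapsTo _ I (I ×ˢ univ) from fun a ha => ⟨ha, mem_univ _⟩)

lemma slice_x (hf : ContDiffOn ℝ 1 f (I ×ˢ univ)) {s : ℝ} (hs : s ∈ I) (x : E3) :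
    HasFDerivAt (fun y => f (s, y))
      ((fderivWithin ℝ f (I ×ˢ univ) (s, x)).comp (ContinuousLinearMap.inr ℝ ℝ E3)) x := by
  have h1 : HasFDerivWithinAt (fun y : E3 => (s, y)) (ContinuousLinearMap.inr ℝ ℝ E3) univ x :=
    (hasFDerivAt_prodMk_right s x).hasFDerivWithinAt
  have := (hfd hf (p := (s, x)) hs).comp x h1
    (show MapsTo _ univ (I ×ˢ univ) from fun a _ => ⟨hs, mem_univ _⟩)
  exact hasFDerivWithinAt_univ.1 this

lemma slice_pdv (hf : ContDiffOn ℝ 1 f (I ×ˢ univ)) {s : ℝ} (hs : s ∈ I) (x : E3) (i : Fin 3) :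
    pdv i (fun y => f (s, y)) x = DD I f (ex i) (s, x) := by
  unfold pdv
  rw [(slice_x hf hs x).fderiv]
  simp [DD, ex]

lemma DD_cont (hI : UniqueDiffOn ℝ I) (hf : ContDiffOn ℝ 1 f (I ×ˢ univ)) (v : ℝ × E3) :
    ContinuousOn (DD I f v) (I ×ˢ univ) :=
  (hf.continuousOn_fderivWithin (hI.prod uniqueDiffOn_univ) le_rfl).clm_apply continuousOn_const

lemma slice_cont (hf : ContinuousOn f (I ×ˢ univ)) {s : ℝ} (hs : s ∈ I) :
    Continuous (fun x => f (s, x)) := by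
  rw [← continuousOn_univ]
  exact hf.comp (by fun_prop) (fun a _ => ⟨hs, mem_univ _⟩)

lemma slice_contDiff (hf : ContDiffOn ℝ 1 f (I ×ˢ univ)) {s : ℝ} (hs : s ∈ I) :
    ContDiff ℝ 1 (fun x => f (s, x)) := by
  rw [← contDiffOn_univ]
  exact hf.comp (by fun_prop) (fun a _ => ⟨hs, mem_univ _⟩)

lemma DD_mul (hI : UniqueDiffOn ℝ I) (hf : ContDiffOn ℝ 1 f (I ×ˢ univ))
    (hg : ContDiffOn ℝ 1 g (I ×ˢ univ)) {p : ℝ × E3} (hp : p.1 ∈ I) (v : ℝ × E3) :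
    DD I (fun p => f p * g p) v p = f p * DD I g v p + g p * DD I f v p := by
  have hu := (hI.prod (uniqueDiffOn_univ (E := E3))) p ⟨hp, mem_univ _⟩
  unfold DD
  rw [((hfd hf hp).fun_mul (hfd hg hp)).fderivWithin hu]
  simp

lemma DD_add (hI : UniqueDiffOn ℝ I) (hf : ContDiffOn ℝ 1 f (I ×ˢ univ))
    (hg : ContDiffOn ℝ 1 g (I ×ˢ univ)) {p : ℝ × E3} (hp : p.1 ∈ I) (v : ℝ × E3) :
    DD I (fun p => f p + g p) v p = DD I f v p + DD I g v p := by
  have hu := (hI.prod (uniqueDiffOn_univ (E := E3))) p ⟨hp, mem_univ _⟩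
  unfold DD
  rw [((hfd hf hp).fun_add (hfd hg hp)).fderivWithin hu]
  simp

lemma DD_const (c : ℝ) (p : ℝ × E3) (v : ℝ × E3) : DD I (fun _ => c) v p = 0 := by
  unfold DD
  simp

end slices

/-! ### Differentiation under the integral and integration by parts -/

lemma deriv_integral {t1 : ℝ} (ht1 : 0 < t1) {f f' : ℝ × E3 → ℝ}
    (hf : ContinuousOn f (Icc 0 t1 ×ˢ univ)) (hf' : ContinuousOn f' (Icc 0 t1 ×ˢ univ))
    (hd : ∀ s ∈ Icc 0 t1, ∀ x, HasDerivWithinAt (fun s => f (s, x)) (f' (s, x)) (Icc 0 t1) s)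
    {K : Set E3} (hK : IsCompact K) (hfK : ∀ s ∈ Icc 0 t1, ∀ x, x ∉ K → f (s, x) = 0)
    {t : ℝ} (ht : t ∈ Icc 0 t1) :
    HasDerivWithinAt (fun s => ∫ x, f (s, x)) (∫ x, f' (t, x)) (Icc 0 t1) t := by
  have hf'K : ∀ s ∈ Icc 0 t1, ∀ x, x ∉ K → f' (s, x) = 0 := by
    intro s hs x hx
    have h0 : HasDerivWithinAt (fun s => f (s, x)) 0 (Icc 0 t1) s :=
      (hasDerivWithinAt_const s (Icc 0 t1) (0 : ℝ)).congr (fun y hy => hfK y hy x hx)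
        (hfK s hs x hx)
    exact (uniqueDiffOn_Icc ht1 s hs).eq_deriv _ (hd s hs x) h0
  obtain ⟨B, hB⟩ := (isCompact_Icc.prod hK).exists_bound_of_continuousOn
    (hf'.mono (prod_mono_right (subset_univ K)))
  have hint : ∀ s ∈ Icc 0 t1, Integrable (fun x => f (s, x)) := fun s hs =>
    (slice_cont hf hs).integrable_of_hasCompactSupport
      (HasCompactSupport.intro hK (fun x hx => hfK s hs x hx))
  rw [hasDerivWithinAt_iff_tendsto_slope]
  have key : Tendsto (fun s => ∫ x, slope (fun s => f (s, x)) t s) (𝓝[Icc 0 t1 \ {t}] t)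
      (𝓝 (∫ x, f' (t, x))) := by
    apply tendsto_integral_filter_of_dominated_convergence (K.indicator fun _ => B)
    · filter_upwards [self_mem_nhdsWithin] with s hs
      simp only [slope_def_field]
      exact (((hint s hs.1).sub (hint t ht)).div_const _).aestronglyMeasurable
    · filter_upwards [self_mem_nhdsWithin] with s hs
      refine ae_of_all _ fun x => ?_
      by_cases hx : x ∈ K
      · rw [indicator_of_mem hx, slope_def_field, norm_div]
        have := (convex_Icc 0 t1).norm_image_sub_le_of_norm_hasDerivWithin_le
          (f := fun s => f (s, x)) (fun y hy => hd y hy x) (fun y hy => hB (y, x) ⟨hy, hx⟩) ht hs.1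
        rw [div_le_iff₀ (norm_pos_iff.2 (sub_ne_zero.2 hs.2))]
        exact this
      · rw [indicator_of_notMem hx, slope_def_field, hfK s hs.1 x hx, hfK t ht x hx]
        simp
    · exact (integrable_indicator_iff hK.measurableSet).2
        (integrableOn_const hK.measure_lt_top.ne)
    · refine ae_of_all _ fun x => ?_
      exact hasDerivWithinAt_iff_tendsto_slope.1 (hd t ht x)
  refine key.congr' ?_
  filter_upwards [self_mem_nhdsWithin] with s hs
  simp only [slope_def_field]
  rw [integral_div, integral_sub (hint s hs.1) (hint t ht)]

lemma pdv_cont {g : E3 → ℝ} (hg : ContDiff ℝ 1 g) (i : Fin 3) : Continuous (pdv i g) :=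
  (hg.continuous_fderiv (by norm_num)).clm_apply continuous_const

lemma pdv_supp {g : E3 → ℝ} (hg : HasCompactSupport g) (i : Fin 3) :
    HasCompactSupport (pdv i g) := by
  have := hg.fderiv ℝ
  exact this.comp_left (g := fun L : E3 →L[ℝ] ℝ => L (EuclideanSpace.single i 1)) (by simp)

lemma int_parts {φ g : E3 → ℝ} (hφ : Differentiable ℝ φ) {i : Fin 3}
    (hφ' : Continuous (pdv i φ)) (hg : ContDiff ℝ 1 g) (hgs : HasCompactSupport g) :
    ∫ x, φ x * pdv i g x = - ∫ x, pdv i φ x * g x := by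
  apply integral_mul_fderiv_eq_neg_fderiv_mul_of_integrable
  · exact (hφ'.mul hg.continuous).integrable_of_hasCompactSupport hgs.mul_left
  · exact (hφ.continuous.mul (pdv_cont hg i)).integrable_of_hasCompactSupport
      (pdv_supp hgs i).mul_left
  · exact (hφ.continuous.mul hg.continuous).integrable_of_hasCompactSupport hgs.mul_left
  · exact fun x _ => hφ x
  · exact fun x _ => hg.differentiable (by norm_num) x

/-! ### Sphere integrals -/

/-- `∫_{S²} e^{ω·x} g(ω) dσ(ω)`. -/
def LL (g : sphere (0 : E3) 1 → ℝ) (x : E3) : ℝ :=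
  ∫ ω : sphere (0 : E3) 1, exp ⟪(ω : E3), x⟫ * g ω ∂sphμ

instance : IsFiniteMeasure sphμ := by unfold sphμ; infer_instance

lemma sph_int {V : Type*} [NormedAddCommGroup V] {h : sphere (0 : E3) 1 → V} (hh : Continuous h) :
    Integrable h sphμ :=
  hh.integrable_of_hasCompactSupport (HasCompactSupport.of_compactSpace h)

lemma LL_deriv {g : sphere (0 : E3) 1 → ℝ} (hg : Continuous g) (x : E3) :
    HasFDerivAt (LL g)
      (∫ ω : sphere (0 : E3) 1, (exp ⟪(ω : E3), x⟫ * g ω) • innerSL ℝ (ω : E3) ∂sphμ) x := by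
  have hco : ∀ x : E3, Continuous fun ω : sphere (0 : E3) 1 => exp ⟪(ω : E3), x⟫ * g ω := by
    intro x; fun_prop
  apply hasFDerivAt_integral_of_dominated_of_fderiv_le (s := ball x 1)
    (bound := fun ω => exp (‖x‖ + 1) * |g ω|) (ball_mem_nhds x one_pos)
  · exact Eventually.of_forall fun y => (hco y).aestronglyMeasurable
  · exact sph_int (hco x)
  · apply Continuous.aestronglyMeasurable
    exact (hco x).smul (by fun_prop)
  · refine ae_of_all _ fun ω y hy => ?_
    have hω : ‖(ω : E3)‖ = 1 := by simp
    rw [norm_smul, innerSL_apply_norm, hω, mul_one, norm_mul, norm_of_nonneg (exp_pos _).le]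
    rw [Real.norm_eq_abs]
    gcongr
    refine (real_inner_le_norm _ _).trans ?_
    rw [hω, one_mul]
    have : ‖y - x‖ < 1 := by simpa [dist_eq_norm] using hy
    linarith [norm_le_norm_add_norm_sub' y x]
  · exact sph_int (by fun_prop)
  · refine ae_of_all _ fun ω y _ => ?_
    have h1 : HasFDerivAt (fun y : E3 => ⟪(ω : E3), y⟫) (innerSL ℝ (ω : E3)) y :=
      (innerSL ℝ (ω : E3)).hasFDerivAt
    have := h1.exp.mul_const (g ω)
    have h2 : (exp ⟪(ω : E3), y⟫ * g ω) • innerSL ℝ (ω : E3)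
        = g ω • exp ⟪(ω : E3), y⟫ • innerSL ℝ (ω : E3) := by
      rw [smul_smul, mul_comm]
    rw [h2]
    exact this

lemma LL_pdv {g : sphere (0 : E3) 1 → ℝ} (hg : Continuous g) (i : Fin 3) :
    pdv i (LL g) = LL (fun ω => g ω * (ω : E3) i) := by
  ext x
  unfold pdv
  rw [(LL_deriv hg x).fderiv, ContinuousLinearMap.integral_apply]
  · unfold LL
    congr 1
    ext ω
    simp [EuclideanSpace.inner_single_right]
    ring
  · apply sph_int
    fun_prop

lemma LL_diff {g : sphere (0 : E3) 1 → ℝ} (hg : Continuous g) : Differentiable ℝ (LL g) :=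
  fun x => (LL_deriv hg x).differentiableAt

/-! ### Energy estimate -/

/-- The Euler system written with derivatives within `I × ℝ³`. -/
structure EulerD (I : Set ℝ) (r : ℝ × E3 → ℝ) (v : Fin 3 → ℝ × E3 → ℝ) : Prop where
  hI : UniqueDiffOn ℝ I
  hr : ContDiffOn ℝ 1 r (I ×ˢ univ)
  hv : ∀ j, ContDiffOn ℝ 1 (v j) (I ×ˢ univ)
  pos : ∀ p : ℝ × E3, p.1 ∈ I → 0 < r p
  mass : ∀ p : ℝ × E3, p.1 ∈ I →
    DD I r et p + ∑ i, DD I (fun p => r p * v i p) (ex i) p = 0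
  mom : ∀ p : ℝ × E3, p.1 ∈ I → ∀ j,
    DD I (fun p => r p * v j p) et p + ∑ i, DD I (fun p => r p * v i p * v j p) (ex i) p
      + DD I (fun p => (r p * r p - 1) * 2⁻¹) (ex j) p = 0

lemma EulerD.of_sol {T : ℝ≥0∞} {ρ : ℝ → E3 → ℝ} {u : ℝ → E3 → E3}
    (h : IsEulerSolution T ρ u) :
    EulerD (timeSet T) (fun p => ρ p.1 p.2) (fun j p => u p.1 p.2 j) := by
  have hr := h.contDiff_rho
  have hv : ∀ j : Fin 3, ContDiffOn ℝ 1 (fun p : ℝ × E3 => u p.1 p.2 j) (timeSet T ×ˢ univ) := by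
    intro j
    exact (EuclideanSpace.proj (𝕜 := ℝ) j).contDiff.comp_contDiffOn h.contDiff_u
  have hI := timeSet_uniqueDiff T
  refine ⟨hI, hr, hv, fun p hp => h.rho_pos _ hp _, ?_, ?_⟩
  · rintro ⟨s, x⟩ hs
    have := h.mass s hs x
    rw [(slice_t hr hs x).derivWithin (hI s hs)] at this
    rw [← this]
    congr 1
    refine Finset.sum_congr rfl fun i _ => ?_
    exact (slice_pdv (hr.mul (hv i)) hs x i).symm
  · rintro ⟨s, x⟩ hs j
    have := h.momentum s hs x j
    rw [(slice_t (hr.mul (hv j)) hs x).derivWithin (hI s hs)] at this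
    rw [← this]
    congr 1
    · congr 1
      refine Finset.sum_congr rfl fun i _ => ?_
      exact (slice_pdv ((hr.mul (hv i)).mul (hv j)) hs x i).symm
    · have h1 : ContDiffOn ℝ 1 (fun p : ℝ × E3 => (ρ p.1 p.2 * ρ p.1 p.2 - 1) * 2⁻¹)
          (timeSet T ×ˢ univ) := ((hr.mul hr).sub contDiffOn_const).mul contDiffOn_const
      refine (slice_pdv h1 hs x j).symm.trans ?_
      unfold pdv
      have : (fun y => ρ s y ^ 2 / 2) = fun y => (ρ s y * ρ s y - 1) * 2⁻¹ + 2⁻¹ := by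
        ext y; ring
      rw [this, fderiv_add_const]

lemma DD_of {I : Set ℝ} (hI : UniqueDiffOn ℝ I) {f : ℝ × E3 → ℝ} {L : ℝ × E3 →L[ℝ] ℝ}
    {p : ℝ × E3} (hp : p.1 ∈ I)
    (h : HasFDerivWithinAt f L (I ×ˢ univ) p) (w : ℝ × E3) : DD I f w p = L w := by
  unfold DD
  rw [h.fderivWithin ((hI.prod (uniqueDiffOn_univ (E := E3))) p ⟨hp, mem_univ _⟩)]

/-- squared speed -/
def NN (v : Fin 3 → ℝ × E3 → ℝ) (p : ℝ × E3) : ℝ := v 0 p * v 0 p + v 1 p * v 1 p + v 2 p * v 2 p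

/-- relative energy -/
def ee (r : ℝ × E3 → ℝ) (v : Fin 3 → ℝ × E3 → ℝ) (p : ℝ × E3) : ℝ :=
  (r p * NN v p + (r p - 1) * (r p - 1)) * 2⁻¹

/-- relative energy flux -/
def FF (r : ℝ × E3 → ℝ) (v : Fin 3 → ℝ × E3 → ℝ) (i : Fin 3) (p : ℝ × E3) : ℝ :=
  v i p * (r p * NN v p * 2⁻¹ + r p * (r p - 1))

section
variable {I : Set ℝ} {r : ℝ × E3 → ℝ} {v : Fin 3 → ℝ × E3 → ℝ}

lemma EulerD.NN_c (h : EulerD I r v) : ContDiffOn ℝ 1 (NN v) (I ×ˢ univ) := by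
  have := h.hv
  exact (((this 0).mul (this 0)).add ((this 1).mul (this 1))).add ((this 2).mul (this 2))

lemma EulerD.ee_c (h : EulerD I r v) : ContDiffOn ℝ 1 (ee r v) (I ×ˢ univ) := by
  have h1 := h.hr.sub (contDiffOn_const (c := (1 : ℝ)))
  exact ((h.hr.mul h.NN_c).add (h1.mul h1)).mul contDiffOn_const

lemma EulerD.FF_c (h : EulerD I r v) (i : Fin 3) : ContDiffOn ℝ 1 (FF r v i) (I ×ˢ univ) := by
  have h1 := h.hr.sub (contDiffOn_const (c := (1 : ℝ)))
  exact (h.hv i).mul (((h.hr.mul h.NN_c).mul contDiffOn_const).add (h.hr.mul h1))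

lemma EulerD.energy (h : EulerD I r v) {p : ℝ × E3} (hp : p.1 ∈ I) :
    DD I (ee r v) et p + ∑ i, DD I (FF r v i) (ex i) p = 0 := by
  have R := hfd h.hr hp
  have V := fun j => hfd (h.hv j) hp
  have N : HasFDerivWithinAt (NN v) _ (I ×ˢ univ) p :=
    (((V 0).fun_mul (V 0)).fun_add ((V 1).fun_mul (V 1))).fun_add ((V 2).fun_mul (V 2))
  have e : HasFDerivWithinAt (ee r v) _ (I ×ˢ univ) p :=
    ((R.fun_mul N).fun_add ((R.sub_const 1).fun_mul (R.sub_const 1))).mul_const 2⁻¹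
  have F : ∀ i, HasFDerivWithinAt (FF r v i) _ (I ×ˢ univ) p := fun i =>
    (V i).fun_mul (((R.fun_mul N).mul_const 2⁻¹).fun_add (R.fun_mul (R.sub_const 1)))
  have m0 := h.mass p hp
  have m := h.mom p hp
  simp only [fun w => DD_of h.hI hp e w, fun i w => DD_of h.hI hp (F i) w]
  simp only [fun i w => DD_of h.hI hp (R.fun_mul (V i)) w,
    fun i j w => DD_of h.hI hp ((R.fun_mul (V i)).fun_mul (V j)) w,
    fun w => DD_of h.hI hp (((R.fun_mul R).sub_const 1).mul_const 2⁻¹) w,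
    fun w => DD_of h.hI hp R w] at m0 m
  have m1 := m 0
  have m2 := m 1
  have m3 := m 2
  clear m
  simp [Fin.sum_univ_three] at m0 m1 m2 m3 ⊢
  unfold NN
  linear_combination v 0 p * m1 + v 1 p * m2 + v 2 p * m3
    + (r p - 1 - (v 0 p * v 0 p + v 1 p * v 1 p + v 2 p * v 2 p) / 2) * m0

end

/-! ### The cone weight -/

/-- The quadratic defining function of the cone with tip direction `x0`. -/
def qq (R : ℝ) (x0 : E3) (p : ℝ × E3) : ℝ :=
  (R - 2 * p.1) * (R - 2 * p.1) - ((p.2 0 - x0 0) * (p.2 0 - x0 0)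
    + (p.2 1 - x0 1) * (p.2 1 - x0 1) + (p.2 2 - x0 2) * (p.2 2 - x0 2))

/-- The weight. -/
def ww (R : ℝ) (x0 : E3) (p : ℝ × E3) : ℝ := expNegInvGlue (qq R x0 p)

lemma qq_eq (R : ℝ) (x0 : E3) (p : ℝ × E3) : qq R x0 p = (R - 2 * p.1) ^ 2 - dist p.2 x0 ^ 2 := by
  rw [dist_eq_norm, EuclideanSpace.norm_sq_eq, Fin.sum_univ_three]
  simp [qq]
  ring

lemma qq_contDiff (R : ℝ) (x0 : E3) : ContDiff ℝ 1 (qq R x0) := by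
  have hc : ∀ i : Fin 3, ContDiff ℝ 1 (fun p : ℝ × E3 => p.2 i - x0 i) := fun i =>
    ((EuclideanSpace.proj (𝕜 := ℝ) i).contDiff.comp contDiff_snd).sub contDiff_const
  have h0 : ContDiff ℝ 1 (fun p : ℝ × E3 => R - 2 * p.1) := by fun_prop
  exact (h0.mul h0).sub ((((hc 0).mul (hc 0)).add ((hc 1).mul (hc 1))).add ((hc 2).mul (hc 2)))

lemma ww_contDiff (R : ℝ) (x0 : E3) : ContDiff ℝ 1 (ww R x0) :=
  (expNegInvGlue.contDiff (n := 1)).comp (qq_contDiff R x0)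

lemma ww_fderiv (R : ℝ) (x0 : E3) (p : ℝ × E3) : ∃ L : ℝ × E3 →L[ℝ] ℝ, HasFDerivAt (ww R x0) L p ∧
    L et = deriv expNegInvGlue (qq R x0 p) * (-4 * (R - 2 * p.1)) ∧
    ∀ i, L (ex i) = deriv expNegInvGlue (qq R x0 p) * (-2 * (p.2 i - x0 i)) := by
  have hc : ∀ i : Fin 3, HasFDerivAt (fun p : ℝ × E3 => p.2 i - x0 i)
      ((EuclideanSpace.proj (𝕜 := ℝ) i : E3 →L[ℝ] ℝ).comp
        (ContinuousLinearMap.snd ℝ ℝ E3)) p := fun i =>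
    (((EuclideanSpace.proj (𝕜 := ℝ) i : E3 →L[ℝ] ℝ).comp
        (ContinuousLinearMap.snd ℝ ℝ E3)).hasFDerivAt).sub_const _
  have h0 : HasFDerivAt (fun p : ℝ × E3 => R - 2 * p.1)
      (-((2 : ℝ) • ContinuousLinearMap.fst ℝ ℝ E3)) p :=
    ((ContinuousLinearMap.fst ℝ ℝ E3).hasFDerivAt.const_mul 2).const_sub R
  have hq : HasFDerivAt (qq R x0) _ p :=
    (h0.fun_mul h0).fun_sub ((((hc 0).fun_mul (hc 0)).fun_add ((hc 1).fun_mul (hc 1))).fun_add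
      ((hc 2).fun_mul (hc 2)))
  have hχ : HasDerivAt expNegInvGlue (deriv expNegInvGlue (qq R x0 p)) (qq R x0 p) :=
    (((expNegInvGlue.contDiff (n := 1)).differentiable (by norm_num)) _).hasDerivAt
  refine ⟨_, hχ.comp_hasFDerivAt p hq, ?_, ?_⟩
  · simp [et]
    ring
  · intro i
    fin_cases i <;> simp [ex] <;> ring

lemma chi_nonneg (x : ℝ) : 0 ≤ deriv expNegInvGlue x := expNegInvGlue.monotone.deriv_nonneg

lemma chi_zero {x : ℝ} (hx : x ≤ 0) : deriv expNegInvGlue x = 0 := by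
  apply IsLocalMin.deriv_eq_zero
  refine Eventually.of_forall fun y => ?_
  rw [expNegInvGlue.zero_of_nonpos hx]
  exact expNegInvGlue.nonneg y

lemma flux_ineq {r a b c x y z d N : ℝ} (hr : 0 < r) (hr2 : r ≤ 9 / 4)
    (hN : N = a * a + b * b + c * c)
    (hN4 : N ≤ 1 / 4) (hd : 0 ≤ d) (hxyz : x * x + y * y + z * z ≤ d * d) :
    -((a * x + b * y + c * z) * (r * N * 2⁻¹ + r * (r - 1)))
      ≤ d * (r * N + (r - 1) * (r - 1)) := by
  have hN0 : 0 ≤ N := by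
    rw [hN]; linarith [mul_self_nonneg a, mul_self_nonneg b, mul_self_nonneg c]
  obtain ⟨S, hS0, hS⟩ : ∃ S : ℝ, 0 ≤ S ∧ S * S = N := ⟨√N, sqrt_nonneg _, mul_self_sqrt hN0⟩
  have hS2 : S ≤ 1 / 2 := by nlinarith
  have h1 : |a * x + b * y + c * z| ≤ S * d := by
    apply abs_le_of_sq_le_sq ?_ (mul_nonneg hS0 hd)
    have : (S * d) ^ 2 = N * (d * d) := by rw [← hS]; ring
    rw [this]
    refine le_trans ?_ (mul_le_mul_of_nonneg_left hxyz hN0)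
    rw [hN]
    nlinarith [sq_nonneg (a * y - b * x), sq_nonneg (a * z - c * x), sq_nonneg (b * z - c * y)]
  have h2 : S * |r * N * 2⁻¹ + r * (r - 1)| ≤ r * N + (r - 1) * (r - 1) := by
    have h3 : |r * N * 2⁻¹ + r * (r - 1)| ≤ r * N * 2⁻¹ + r * |r - 1| := by
      refine (abs_add_le _ _).trans ?_
      rw [abs_of_nonneg (by positivity : 0 ≤ r * N * 2⁻¹), abs_mul, abs_of_pos hr]
    refine (mul_le_mul_of_nonneg_left h3 hS0).trans ?_
    have h4 : |r - 1| * |r - 1| = (r - 1) * (r - 1) := abs_mul_abs_self _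
    rw [← h4]
    have h5 : S * (r * N) ≤ 1 / 2 * (r * N) := mul_le_mul_of_nonneg_right hS2 (by positivity)
    have h6 : r * (r * N) ≤ 9 / 4 * (r * N) := mul_le_mul_of_nonneg_right hr2 (by positivity)
    have h7 : (r * S) * (r * S) = r * (r * N) := by rw [← hS]; ring
    nlinarith [sq_nonneg (2 * (r * S) - 3 * |r - 1|), abs_nonneg (r - 1)]
  calc -((a * x + b * y + c * z) * (r * N * 2⁻¹ + r * (r - 1)))
      ≤ |a * x + b * y + c * z| * |r * N * 2⁻¹ + r * (r - 1)| := by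
        rw [← abs_mul]; exact neg_le_abs _
    _ ≤ S * d * |r * N * 2⁻¹ + r * (r - 1)| := by gcongr
    _ = d * (S * |r * N * 2⁻¹ + r * (r - 1)|) := by ring
    _ ≤ _ := by gcongr

/-! ### Finite propagation speed -/

section
variable {I : Set ℝ} {r : ℝ × E3 → ℝ} {v : Fin 3 → ℝ × E3 → ℝ}

lemma NN_nonneg (v : Fin 3 → ℝ × E3 → ℝ) (p : ℝ × E3) : 0 ≤ NN v p := by
  unfold NN
  linarith [mul_self_nonneg (v 0 p), mul_self_nonneg (v 1 p), mul_self_nonneg (v 2 p)]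

lemma EulerD.ee_nonneg (h : EulerD I r v) {p : ℝ × E3} (hp : p.1 ∈ I) : 0 ≤ ee r v p := by
  have := mul_nonneg (h.pos p hp).le (NN_nonneg v p)
  have := mul_self_nonneg (r p - 1)
  unfold ee
  linarith

lemma EulerD.ee_zero (h : EulerD I r v) {p : ℝ × E3} (hp : p.1 ∈ I) (he : ee r v p = 0) :
    r p = 1 ∧ ∀ j, v j p = 0 := by
  have h1 := mul_nonneg (h.pos p hp).le (NN_nonneg v p)
  have h2 := mul_self_nonneg (r p - 1)
  unfold ee at he
  have h3 : r p * NN v p = 0 := by linarith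
  have h4 : (r p - 1) * (r p - 1) = 0 := by linarith
  have h5 : NN v p = 0 := (mul_eq_zero.1 h3).resolve_left (h.pos p hp).ne'
  have h6 := mul_self_eq_zero.1 h4
  refine ⟨by linarith, ?_⟩
  unfold NN at h5
  have a0 := mul_self_nonneg (v 0 p)
  have a1 := mul_self_nonneg (v 1 p)
  have a2 := mul_self_nonneg (v 2 p)
  intro j
  apply mul_self_eq_zero.1
  fin_cases j <;> simp only [Fin.zero_eta, Fin.mk_one, Fin.reduceFinMk] <;> linarith

lemma ww_zero {R : ℝ} {x0 : E3} {s : ℝ} (hs : 0 ≤ s) (hsR : 2 * s ≤ R) {x : E3}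
    (hx : x ∉ closedBall x0 R) : ww R x0 (s, x) = 0 := by
  apply expNegInvGlue.zero_of_nonpos
  rw [qq_eq]
  have : R < dist x x0 := by simpa using hx
  simp only
  nlinarith

lemma EulerD.diss (h : EulerD I r v) {s : ℝ} (hs : s ∈ I) (hs0 : 0 ≤ s) {R : ℝ} (hsR : 2 * s ≤ R)
    {x0 : E3} (hb : ∀ x ∈ closedBall x0 (R - 2 * s), NN v (s, x) ≤ 1 / 4 ∧ r (s, x) ≤ 9 / 4) :
    ∫ x, DD I (fun p => ww R x0 p * ee r v p) et (s, x) ≤ 0 := by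
  have hw := (ww_contDiff R x0).contDiffOn (s := I ×ˢ univ)
  have hws : HasCompactSupport (fun x => ww R x0 (s, x)) :=
    HasCompactSupport.intro (isCompact_closedBall x0 R) (fun x hx => ww_zero hs0 hsR hx)
  have hwc := slice_contDiff hw hs
  -- integrability
  have i1 : ∀ i, Integrable (fun x => DD I (FF r v i) (ex i) (s, x) * ww R x0 (s, x)) := fun i =>
    ((slice_cont (DD_cont h.hI (h.FF_c i) (ex i)) hs).mul hwc.continuous)
      |>.integrable_of_hasCompactSupport hws.mul_left
  have ewx : ∀ i x, DD I (ww R x0) (ex i) (s, x) = pdv i (fun y => ww R x0 (s, y)) x :=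
    fun i x => (slice_pdv hw hs x i).symm
  have i2 : ∀ i, Integrable (fun x => FF r v i (s, x) * DD I (ww R x0) (ex i) (s, x)) := fun i => by
    simp only [ewx]
    exact ((slice_cont (h.FF_c i).continuousOn hs).mul (pdv_cont hwc i))
      |>.integrable_of_hasCompactSupport (pdv_supp hws i).mul_left
  have ibp : ∀ i, ∫ x, FF r v i (s, x) * DD I (ww R x0) (ex i) (s, x)
      = - ∫ x, DD I (FF r v i) (ex i) (s, x) * ww R x0 (s, x) := fun i => by
    simp only [ewx]
    rw [int_parts ((slice_contDiff (h.FF_c i) hs).differentiable (by norm_num))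
      (pdv_cont (slice_contDiff (h.FF_c i) hs) i) hwc hws]
    simp only [slice_pdv (h.FF_c i) hs]
  have hA : ∀ x, DD I (fun p => ww R x0 p * ee r v p) et (s, x)
        = ee r v (s, x) * DD I (ww R x0) et (s, x)
          - ∑ i, DD I (FF r v i) (ex i) (s, x) * ww R x0 (s, x) := fun x => by
    rw [DD_mul h.hI hw h.ee_c hs, ← Finset.sum_mul]
    linear_combination ww R x0 (s, x) * h.energy (p := (s, x)) hs
  have i3 : Integrable (fun x => ee r v (s, x) * DD I (ww R x0) et (s, x)) := by
    apply (((slice_cont h.ee_c.continuousOn hs).mul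
      (slice_cont (DD_cont h.hI hw et) hs))).integrable_of_hasCompactSupport
    refine HasCompactSupport.intro (isCompact_closedBall x0 R) (fun x hx => ?_)
    obtain ⟨L, hL, hLt, -⟩ := ww_fderiv R x0 (s, x)
    change ee r v (s, x) * DD I (ww R x0) et (s, x) = 0
    rw [DD_of h.hI (p := (s, x)) hs hL.hasFDerivWithinAt, hLt, chi_zero]
    · simp
    · exact expNegInvGlue.zero_iff_nonpos.1 (ww_zero hs0 hsR hx)
  have key : ∫ x, DD I (fun p => ww R x0 p * ee r v p) et (s, x)
      = ∫ x, (ee r v (s, x) * DD I (ww R x0) et (s, x)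
        + ∑ i, FF r v i (s, x) * DD I (ww R x0) (ex i) (s, x)) := by
    simp_rw [hA]
    rw [integral_sub i3 (integrable_finsetSum _ fun i _ => i1 i),
      integral_add i3 (integrable_finsetSum _ fun i _ => i2 i),
      integral_finsetSum _ fun i _ => i1 i, integral_finsetSum _ fun i _ => i2 i]
    simp only [ibp, Finset.sum_neg_distrib]
    ring
  rw [key]
  apply integral_nonpos
  intro x
  simp only [Pi.zero_apply]
  obtain ⟨L, hL, hLt, hLx⟩ := ww_fderiv R x0 (s, x)
  simp only [DD_of h.hI (p := (s, x)) hs hL.hasFDerivWithinAt, hLt, hLx]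
  rcases le_or_gt (qq R x0 (s, x)) 0 with hq | hq
  · simp [chi_zero hq]
  · have hq' := hq
    rw [qq_eq] at hq'
    simp only at hq'
    have hd : dist x x0 ≤ R - 2 * s := by
      apply le_of_lt
      apply lt_of_pow_lt_pow_left₀ 2 (by linarith)
      linarith
    obtain ⟨b1, b2⟩ := hb x hd
    have hxyz : (x 0 - x0 0) * (x 0 - x0 0) + (x 1 - x0 1) * (x 1 - x0 1)
        + (x 2 - x0 2) * (x 2 - x0 2) ≤ (R - 2 * s) * (R - 2 * s) := by
      have := hq.le
      unfold qq at this
      simp only at this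
      linarith
    have fi := flux_ineq (h.pos (s, x) hs) b2 (rfl : NN v (s, x) = _) b1
      (by linarith : 0 ≤ R - 2 * s) hxyz
    have := mul_le_mul_of_nonneg_left fi (chi_nonneg (qq R x0 (s, x)))
    simp only [Fin.sum_univ_three, FF, ee]
    linarith

lemma EulerD.cone (h : EulerD I r v) {t1 : ℝ} (ht1 : 0 < t1) (hI1 : Icc 0 t1 ⊆ I)
    {x0 : E3} (h0 : ∀ x ∈ ball x0 (2 * t1 + 1), r (0, x) = 1 ∧ ∀ j, v j (0, x) = 0)
    {s : ℝ} (hs : s ∈ Icc 0 t1) : r (s, x0) = 1 ∧ ∀ j, v j (s, x0) = 0 := by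
  set R := 2 * t1 + 1 with hR
  set f : ℝ × E3 → ℝ := fun p => ww R x0 p * ee r v p with hf
  have hfc : ContDiffOn ℝ 1 f (I ×ˢ univ) := (ww_contDiff R x0).contDiffOn.mul h.ee_c
  have hsub : Icc 0 t1 ×ˢ (univ : Set E3) ⊆ I ×ˢ univ := prod_mono_left hI1
  have hfK : ∀ s ∈ Icc 0 t1, ∀ x, x ∉ closedBall x0 R → f (s, x) = 0 := fun s hs x hx => by
    simp only [hf]
    rw [ww_zero hs.1 (by linarith [hs.2]) hx, zero_mul]
  have hE : ∀ t ∈ Icc 0 t1, HasDerivWithinAt (fun s => ∫ x, f (s, x)) (∫ x, DD I f et (t, x))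
      (Icc 0 t1) t := fun t ht =>
    deriv_integral ht1 (hfc.continuousOn.mono hsub) ((DD_cont h.hI hfc et).mono hsub)
      (fun s hs x => (slice_t hfc (hI1 hs) x).mono hI1) (isCompact_closedBall x0 R) hfK ht
  have hEc : ContinuousOn (fun s => ∫ x, f (s, x)) (Icc 0 t1) :=
    fun t ht => (hE t ht).continuousWithinAt
  have hfn : ∀ s ∈ Icc 0 t1, ∀ x, 0 ≤ f (s, x) := fun s hs x =>
    mul_nonneg (expNegInvGlue.nonneg _) (h.ee_nonneg (hI1 hs))
  -- vanishing energy means a trivial state on the ball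
  have triv : ∀ s ∈ Icc 0 t1, (∫ x, f (s, x)) ≤ 0 →
      ∀ x ∈ ball x0 (R - 2 * s), r (s, x) = 1 ∧ ∀ j, v j (s, x) = 0 := by
    intro s hs hle x hx
    have hz : f (s, x) = 0 := by
      by_contra hne
      have := (slice_cont hfc.continuousOn (hI1 hs)).integral_pos_of_hasCompactSupport_nonneg_nonzero
        (μ := volume) (HasCompactSupport.intro (isCompact_closedBall x0 R) (hfK s hs)) (hfn s hs) hne
      linarith
    have hw : 0 < ww R x0 (s, x) := by
      apply expNegInvGlue.pos_of_pos
      rw [qq_eq]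
      have : dist x x0 < R - 2 * s := hx
      simp only
      nlinarith [dist_nonneg (x := x) (y := x0)]
    exact h.ee_zero (hI1 hs) ((mul_eq_zero.1 hz).resolve_left hw.ne')
  have main : Icc 0 t1 ⊆ {s | (∫ x, f (s, x)) ≤ 0} := by
    apply IsClosed.Icc_subset_of_forall_mem_nhdsWithin
    · have := hEc.preimage_isClosed_of_isClosed isClosed_Icc (isClosed_Iic (a := (0 : ℝ)))
      rw [inter_comm]
      exact this
    · have : ∀ x, f (0, x) = 0 := by
        intro x
        by_cases hx : x ∈ ball x0 R
        · obtain ⟨a, b⟩ := h0 x hx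
          simp [hf, ee, NN, a, b]
        · simp only [hf]
          have : ww R x0 (0, x) = 0 := by
            apply expNegInvGlue.zero_of_nonpos
            rw [qq_eq]
            have : R ≤ dist x x0 := by simpa using hx
            simp only
            nlinarith
          rw [this, zero_mul]
      simp [this]
    · rintro s ⟨hsle, hs⟩
      have hs' : s ∈ Icc 0 t1 := Ico_subset_Icc_self hs
      have hrad : 0 < R - 2 * s := by linarith [hs.2]
      have hcl : ∀ x ∈ closedBall x0 (R - 2 * s), r (s, x) = 1 ∧ ∀ j, v j (s, x) = 0 := by
        have hc : IsClosed {x | r (s, x) = 1 ∧ ∀ j, v j (s, x) = 0} := by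
          have h1 : IsClosed {x | r (s, x) = 1} :=
            isClosed_eq (slice_cont h.hr.continuousOn (hI1 hs')) continuous_const
          have h2 : ∀ j, IsClosed {x | v j (s, x) = 0} := fun j =>
            isClosed_eq (slice_cont (h.hv j).continuousOn (hI1 hs')) continuous_const
          have h3 : {x | r (s, x) = 1 ∧ ∀ j, v j (s, x) = 0}
              = {x | r (s, x) = 1} ∩ ⋂ j, {x | v j (s, x) = 0} := by
            ext x; simp
          rw [h3]
          exact h1.inter (isClosed_iInter h2)
        rw [← closure_ball x0 hrad.ne']
        exact closure_minimal (triv s hs' hsle) hc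
      have hev : ∀ᶠ s' in 𝓝 s, ∀ x ∈ closedBall x0 (R - 2 * s), s' ∈ I →
          (NN v (s', x) < 1 / 4 ∧ r (s', x) < 9 / 4) := by
        apply (isCompact_closedBall x0 (R - 2 * s)).eventually_forall_of_forall_eventually
        intro x hx
        obtain ⟨a, b⟩ := hcl x hx
        have hm : (s, x) ∈ I ×ˢ (univ : Set E3) := ⟨hI1 hs', mem_univ _⟩
        have e1 : ∀ᶠ p in 𝓝[I ×ˢ univ] (s, x), NN v p < 1 / 4 :=
          (h.NN_c.continuousOn _ hm).eventually_lt_const (by simp [NN, b])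
        have e2 : ∀ᶠ p in 𝓝[I ×ˢ univ] (s, x), r p < 9 / 4 :=
          (h.hr.continuousOn _ hm).eventually_lt_const (by rw [a]; norm_num)
        filter_upwards [eventually_nhdsWithin_iff.1 e1, eventually_nhdsWithin_iff.1 e2]
          with p p1 p2 hp
        exact ⟨p1 ⟨hp, mem_univ _⟩, p2 ⟨hp, mem_univ _⟩⟩
      obtain ⟨δ, hδ, hball⟩ := Metric.eventually_nhds_iff.1 hev
      have hlt : s < min (s + δ) t1 := lt_min (by linarith) hs.2
      filter_upwards [Ioo_mem_nhdsGT hlt] with s' hs1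
      have hs't : s' ≤ t1 := hs1.2.le.trans (min_le_right _ _)
      have hs'δ : s' < s + δ := hs1.2.trans_le (min_le_left _ _)
      have hss : Icc s s' ⊆ Icc 0 t1 := Icc_subset_Icc hs.1 hs't
      have anti : AntitoneOn (fun s => ∫ x, f (s, x)) (Icc s s') := by
        apply antitoneOn_of_hasDerivWithinAt_nonpos (convex_Icc _ _) (hEc.mono hss)
          (f' := fun t => ∫ x, DD I f et (t, x))
        · intro t ht
          exact (hE t (hss (interior_subset ht))).mono (interior_subset.trans hss)
        · intro t ht
          have ht' := interior_subset ht
          have ht2 := hss ht'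
          refine h.diss (hI1 ht2) ht2.1 (by linarith [ht2.2]) fun x hx => ?_
          have := hball (y := t) (by
            rw [Real.dist_eq, abs_of_nonneg (by linarith [ht'.1])]
            linarith [ht'.2]) x (closedBall_subset_closedBall (by linarith [ht'.1]) hx) (hI1 ht2)
          exact ⟨this.1.le, this.2.le⟩
      have hle : s ≤ s' := hs1.1.le
      exact (anti (left_mem_Icc.2 hle) (right_mem_Icc.2 hle) hle).trans hsle
  exact triv s hs (main hs) x0 (mem_ball_self (by linarith [hs.2]))

end

/-! ### Main computation -/

lemma inner_coord (a b : E3) : ⟪a, b⟫ = ∑ j, a j * b j := by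
  rw [PiLp.inner_apply]
  refine Finset.sum_congr rfl fun j _ => ?_
  simp [mul_comm]

lemma exp_int {g : sphere (0 : E3) 1 → ℝ} (hg : Continuous g) (x : E3) :
    Integrable (fun ω : sphere (0 : E3) 1 => exp ⟪(ω : E3), x⟫ * g ω) sphμ :=
  sph_int (by fun_prop)

lemma sph1 (x a : E3) (c : ℝ) :
    ∫ ω : sphere (0 : E3) 1, exp ⟪(ω : E3), x⟫ * (c * ⟪a, (ω : E3)⟫) ∂sphμ
      = ∑ j, c * a j * LL (fun ω => (ω : E3) j) x := by
  have : ∀ ω : sphere (0 : E3) 1, exp ⟪(ω : E3), x⟫ * (c * ⟪a, (ω : E3)⟫)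
      = ∑ j, c * a j * (exp ⟪(ω : E3), x⟫ * (ω : E3) j) := by
    intro ω
    rw [inner_coord a, Finset.mul_sum, Finset.mul_sum]
    refine Finset.sum_congr rfl fun j _ => ?_
    ring
  simp_rw [this]
  rw [integral_finsetSum]
  · simp only [integral_const_mul, LL]
  · intro j _
    exact (exp_int (g := fun ω => (ω : E3) j) (by fun_prop) x).const_mul _

lemma sph2 (x a : E3) (c : ℝ) :
    ∫ ω : sphere (0 : E3) 1, exp ⟪(ω : E3), x⟫ * (c * ⟪a, (ω : E3)⟫ ^ 2) ∂sphμ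
      = ∑ j, ∑ i, LL (fun ω => (ω : E3) j * (ω : E3) i) x * (c * a i * a j) := by
  have : ∀ ω : sphere (0 : E3) 1, exp ⟪(ω : E3), x⟫ * (c * ⟪a, (ω : E3)⟫ ^ 2)
      = ∑ j, ∑ i, (exp ⟪(ω : E3), x⟫ * ((ω : E3) j * (ω : E3) i)) * (c * a i * a j) := by
    intro ω
    rw [inner_coord a, sq, Finset.sum_mul_sum, Finset.mul_sum, Finset.mul_sum]
    refine Finset.sum_congr rfl fun j _ => ?_
    rw [Finset.mul_sum, Finset.mul_sum]
    refine Finset.sum_congr rfl fun i _ => ?_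
    ring
  have hi : ∀ j i : Fin 3, Integrable (fun ω : sphere (0 : E3) 1 =>
      (exp ⟪(ω : E3), x⟫ * ((ω : E3) j * (ω : E3) i)) * (c * a i * a j)) sphμ := fun j i =>
    (exp_int (g := fun ω => (ω : E3) j * (ω : E3) i) (by fun_prop) x).mul_const _
  simp_rw [this]
  rw [integral_finsetSum _ fun j _ => integrable_finsetSum _ fun i _ => hi j i]
  refine Finset.sum_congr rfl fun j _ => ?_
  rw [integral_finsetSum _ fun i _ => hi j i]
  simp only [integral_mul_const, LL]

lemma sph3 (x : E3) (c : ℝ) :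
    ∫ ω : sphere (0 : E3) 1, exp ⟪(ω : E3), x⟫ * c ∂sphμ
      = ∑ j, LL (fun ω => (ω : E3) j * (ω : E3) j) x * c := by
  have : ∀ ω : sphere (0 : E3) 1, exp ⟪(ω : E3), x⟫ * c
      = ∑ j, (exp ⟪(ω : E3), x⟫ * ((ω : E3) j * (ω : E3) j)) * c := by
    intro ω
    have h1 : ∑ j, (ω : E3) j * (ω : E3) j = 1 := by
      rw [← inner_coord, real_inner_self_eq_norm_sq]
      simp
    rw [← Finset.sum_mul, ← Finset.mul_sum, h1, mul_one]
  simp_rw [this]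
  rw [integral_finsetSum]
  · simp only [integral_mul_const, LL]
  · intro j _
    exact (exp_int (g := fun ω => (ω : E3) j * (ω : E3) j) (by fun_prop) x).mul_const _

lemma EulerD.main {I : Set ℝ} {r : ℝ × E3 → ℝ} {v : Fin 3 → ℝ × E3 → ℝ}
    (h : EulerD I r v) {t1 : ℝ} (ht1 : 0 < t1) (hI1 : Icc 0 t1 ⊆ I)
    {K : Set E3} (hK : IsCompact K)
    (hKs : ∀ s ∈ Icc 0 t1, ∀ x, x ∉ K → r (s, x) = 1 ∧ ∀ j, v j (s, x) = 0)
    {t : ℝ} (ht : t ∈ Icc 0 t1) :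
    HasDerivWithinAt (fun s => ∫ x, ∑ j, r (s, x) * v j (s, x) * LL (fun ω => (ω : E3) j) x)
      ((∫ x, ∑ j, ∑ i, LL (fun ω => (ω : E3) j * (ω : E3) i) x * (r (t, x) * v i (t, x) * v j (t, x)))
        + (1 / 2) * ∫ x, ∑ j, LL (fun ω => (ω : E3) j * (ω : E3) j) x * (r (t, x) ^ 2 - 1))
      (Icc 0 t1) t := by
  have hsub : Icc 0 t1 ×ˢ (univ : Set E3) ⊆ I ×ˢ univ := prod_mono_left hI1
  have htI := hI1 ht
  have hg : ∀ j : Fin 3, Continuous (fun ω : sphere (0 : E3) 1 => (ω : E3) j) := fun j => by fun_prop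
  have hg2 : ∀ j i : Fin 3, Continuous (fun ω : sphere (0 : E3) 1 => (ω : E3) j * (ω : E3) i) :=
    fun j i => by fun_prop
  have hLd := fun j => LL_diff (hg j)
  have hLd2 := fun j i => LL_diff (hg2 j i)
  have hrv : ∀ j, ContDiffOn ℝ 1 (fun p => r p * v j p) (I ×ˢ univ) := fun j => h.hr.mul (h.hv j)
  have hrvv : ∀ i j, ContDiffOn ℝ 1 (fun p => r p * v i p * v j p) (I ×ˢ univ) :=
    fun i j => (hrv i).mul (h.hv j)
  have hrr : ContDiffOn ℝ 1 (fun p => (r p * r p - 1) * 2⁻¹) (I ×ˢ univ) :=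
    ((h.hr.mul h.hr).sub contDiffOn_const).mul contDiffOn_const
  have svv : ∀ i j, HasCompactSupport (fun x => r (t, x) * v i (t, x) * v j (t, x)) := fun i j =>
    HasCompactSupport.intro hK fun x hx => by simp [(hKs t ht x hx).2]
  have srr : HasCompactSupport (fun x => (r (t, x) * r (t, x) - 1) * 2⁻¹) :=
    HasCompactSupport.intro hK fun x hx => by simp [(hKs t ht x hx).1]
  have cvv := fun i j => slice_contDiff (hrvv i j) htI
  have crr := slice_contDiff hrr htI
  have D := deriv_integral ht1
    (f := fun p => ∑ j, r p * v j p * LL (fun ω => (ω : E3) j) p.2)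
    (f' := fun p => ∑ j, DD I (fun p => r p * v j p) et p * LL (fun ω => (ω : E3) j) p.2)
    (continuousOn_finsetSum _ fun j _ => ((hrv j).continuousOn.mono hsub).mul
      ((hLd j).continuous.comp continuous_snd).continuousOn)
    (continuousOn_finsetSum _ fun j _ => ((DD_cont h.hI (hrv j) et).mono hsub).mul
      ((hLd j).continuous.comp continuous_snd).continuousOn)
    (fun s hs x => HasDerivWithinAt.fun_sum fun j _ =>
      ((slice_t (hrv j) (hI1 hs) x).mono hI1).mul_const (LL (fun ω => (ω : E3) j) x))
    hK (fun s hs x hx => by simp [(hKs s hs x hx).2]) ht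
  convert D using 1
  have pL : ∀ j i x, pdv i (LL (fun ω => (ω : E3) j)) x
      = LL (fun ω => (ω : E3) j * (ω : E3) i) x := fun j i x => by rw [LL_pdv (hg j)]
  have cpL : ∀ j i, Continuous (pdv i (LL (fun ω => (ω : E3) j))) := fun j i => by
    rw [LL_pdv (hg j)]; exact (hLd2 j i).continuous
  have p1 : ∀ j i, ∫ x, LL (fun ω => (ω : E3) j) x * pdv i (fun y => r (t, y) * v i (t, y) * v j (t, y)) x
      = - ∫ x, LL (fun ω => (ω : E3) j * (ω : E3) i) x * (r (t, x) * v i (t, x) * v j (t, x)) :=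
    fun j i => by
      rw [int_parts (hLd j) (cpL j i) (cvv i j) (svv i j)]
      simp only [pL]
  have p2 : ∀ j, ∫ x, LL (fun ω => (ω : E3) j) x * pdv j (fun y => (r (t, y) * r (t, y) - 1) * 2⁻¹) x
      = - ∫ x, LL (fun ω => (ω : E3) j * (ω : E3) j) x * ((r (t, x) * r (t, x) - 1) * 2⁻¹) :=
    fun j => by
      rw [int_parts (hLd j) (cpL j j) crr srr]
      simp only [pL]
  have i1 : ∀ j i, Integrable fun x =>
      LL (fun ω => (ω : E3) j) x * pdv i (fun y => r (t, y) * v i (t, y) * v j (t, y)) x := fun j i =>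
    ((hLd j).continuous.mul (pdv_cont (cvv i j) i)).integrable_of_hasCompactSupport
      (pdv_supp (svv i j) i).mul_left
  have i2 : ∀ j, Integrable fun x =>
      LL (fun ω => (ω : E3) j) x * pdv j (fun y => (r (t, y) * r (t, y) - 1) * 2⁻¹) x := fun j =>
    ((hLd j).continuous.mul (pdv_cont crr j)).integrable_of_hasCompactSupport
      (pdv_supp srr j).mul_left
  have i3 : ∀ j i, Integrable fun x =>
      LL (fun ω => (ω : E3) j * (ω : E3) i) x * (r (t, x) * v i (t, x) * v j (t, x)) := fun j i =>
    ((hLd2 j i).continuous.mul (cvv i j).continuous).integrable_of_hasCompactSupport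
      (svv i j).mul_left
  have i4 : ∀ j, Integrable fun x =>
      LL (fun ω => (ω : E3) j * (ω : E3) j) x * ((r (t, x) * r (t, x) - 1) * 2⁻¹) := fun j =>
    ((hLd2 j j).continuous.mul crr.continuous).integrable_of_hasCompactSupport srr.mul_left
  have e1 : ∀ x, ∑ j, DD I (fun p => r p * v j p) et (t, x) * LL (fun ω => (ω : E3) j) x
      = ∑ j, (-(∑ i, LL (fun ω => (ω : E3) j) x
            * pdv i (fun y => r (t, y) * v i (t, y) * v j (t, y)) x)
          - LL (fun ω => (ω : E3) j) x * pdv j (fun y => (r (t, y) * r (t, y) - 1) * 2⁻¹) x) := by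
    intro x
    refine Finset.sum_congr rfl fun j _ => ?_
    have m := h.mom (t, x) htI j
    rw [← Finset.mul_sum]
    simp only [fun i => slice_pdv (hrvv i j) htI x i, slice_pdv hrr htI x j]
    linear_combination LL (fun ω => (ω : E3) j) x * m
  simp only [e1]
  have i6 : ∀ j, Integrable fun x => -(∑ i, LL (fun ω => (ω : E3) j) x
      * pdv i (fun y => r (t, y) * v i (t, y) * v j (t, y)) x) :=
    fun j => (integrable_finsetSum Finset.univ fun i _ => i1 j i).neg
  have i5 : ∀ j, Integrable fun x => -(∑ i, LL (fun ω => (ω : E3) j) x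
      * pdv i (fun y => r (t, y) * v i (t, y) * v j (t, y)) x)
      - LL (fun ω => (ω : E3) j) x * pdv j (fun y => (r (t, y) * r (t, y) - 1) * 2⁻¹) x :=
    fun j => (i6 j).sub (i2 j)
  rw [integral_finsetSum _ fun j _ => i5 j]
  have e2 : ∀ j, ∫ x, (-(∑ i, LL (fun ω => (ω : E3) j) x
            * pdv i (fun y => r (t, y) * v i (t, y) * v j (t, y)) x)
          - LL (fun ω => (ω : E3) j) x * pdv j (fun y => (r (t, y) * r (t, y) - 1) * 2⁻¹) x)
      = (∑ i, ∫ x, LL (fun ω => (ω : E3) j * (ω : E3) i) x * (r (t, x) * v i (t, x) * v j (t, x)))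
        + ∫ x, LL (fun ω => (ω : E3) j * (ω : E3) j) x * ((r (t, x) * r (t, x) - 1) * 2⁻¹) := by
    intro j
    rw [integral_sub (i6 j) (i2 j), integral_neg,
      integral_finsetSum _ fun i _ => i1 j i, p2]
    simp only [p1, Finset.sum_neg_distrib]
    ring
  simp only [e2]
  rw [Finset.sum_add_distrib,
    integral_finsetSum _ fun j _ => integrable_finsetSum _ fun i _ => i3 j i]
  congr 1
  · refine Finset.sum_congr rfl fun j _ => ?_
    rw [integral_finsetSum _ fun i _ => i3 j i]
  · rw [← integral_const_mul, ← integral_finsetSum _ fun j _ => i4 j]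
    congr 1
    ext x
    rw [Finset.mul_sum]
    refine Finset.sum_congr rfl fun j _ => ?_
    ring

/-- For a classical solution of the 3D compressible Euler equations with `ρ(t,·) − 1` and
`u(t,·)` compactly supported, the function
`Y(t) = ∫_{ℝ³}∫_{S²} e^{ω·x} ρ(t,x)(u(t,x)·ω) dσ(ω) dx` is differentiable with
`Y'(t) = ∫∫ e^{ω·x} ρ (u·ω)² + (1/2)∫∫ e^{ω·x}(ρ² − 1)`. -/
theorem euler_Y_deriv
    (T : ℝ≥0∞) (ρ : ℝ → E3 → ℝ) (u : ℝ → E3 → E3)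
    (hsol : IsEulerSolution T ρ u)
    (hρsupp : ∀ t ∈ timeSet T, HasCompactSupport (fun x => ρ t x - 1))
    (husupp : ∀ t ∈ timeSet T, HasCompactSupport (u t)) :
    ∀ t ∈ timeSet T,
      HasDerivWithinAt
        (fun s => ∫ x : E3, ∫ ω : sphere (0 : E3) 1,
          exp ⟪(ω : E3), x⟫ * (ρ s x * ⟪u s x, (ω : E3)⟫) ∂sphμ)
        ((∫ x : E3, ∫ ω : sphere (0 : E3) 1,
            exp ⟪(ω : E3), x⟫ * (ρ t x * ⟪u t x, (ω : E3)⟫ ^ 2) ∂sphμ)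
          + (1 / 2) * ∫ x : E3, ∫ ω : sphere (0 : E3) 1,
            exp ⟪(ω : E3), x⟫ * (ρ t x ^ 2 - 1) ∂sphμ)
        (timeSet T) t := by
  intro t ht
  have h := EulerD.of_sol hsol
  obtain ⟨t1, ht1, htt1⟩ := exists_later ht
  have ht10 : 0 < t1 := lt_of_le_of_lt ht.1 htt1
  have hI1 := Icc_subset_timeSet ht1
  have h0 : (0 : ℝ) ∈ timeSet T := hI1 ⟨le_rfl, ht10.le⟩
  obtain ⟨R0, hR0⟩ := ((hρsupp 0 h0).isCompact.union (husupp 0 h0).isCompact).isBounded.subset_closedBall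
    (0 : E3)
  have htriv : ∀ x : E3, R0 < ‖x‖ → ρ 0 x = 1 ∧ ∀ j, u 0 x j = 0 := by
    intro x hx
    have hx' : x ∉ closedBall (0 : E3) R0 := by simpa using hx
    have h1 : x ∉ tsupport (fun x => ρ 0 x - 1) := fun hh => hx' (hR0 (Or.inl hh))
    have h2 : x ∉ tsupport (u 0) := fun hh => hx' (hR0 (Or.inr hh))
    have h3 : ρ 0 x - 1 = 0 :=
      image_eq_zero_of_notMem_tsupport (f := fun x => ρ 0 x - 1) h1
    have h4 : u 0 x = 0 := image_eq_zero_of_notMem_tsupport h2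
    exact ⟨by linarith, fun j => by simp [h4]⟩
  have hKs : ∀ s ∈ Icc 0 t1, ∀ x, x ∉ closedBall (0 : E3) (R0 + (2 * t1 + 1)) →
      ρ s x = 1 ∧ ∀ j, u s x j = 0 := by
    intro s hs x hx
    have hx' : R0 + (2 * t1 + 1) < ‖x‖ := by simpa using hx
    refine h.cone ht10 hI1 (x0 := x) (fun y hy => htriv y ?_) hs
    have hy' : ‖y - x‖ < 2 * t1 + 1 := by simpa [dist_eq_norm] using hy
    have := norm_sub_norm_le x y
    rw [norm_sub_rev] at this
    linarith
  have D := h.main ht10 hI1 (isCompact_closedBall _ _) hKs (t := t) ⟨ht.1, htt1.le⟩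
  simp only [sph1, sph2, sph3]
  apply D.mono_of_mem_nhdsWithin
  filter_upwards [self_mem_nhdsWithin, mem_nhdsWithin_of_mem_nhds (Iio_mem_nhds htt1)] with s hs hs1
  exact ⟨hs.1, le_of_lt hs1⟩

end
end
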